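/- For every nonnegative integer n, the number of diagonal-lattice walks of length 2n that start at (0,0), end at (−2,0), and are confined to the three-quadrant cone C equals (16^n / 9) · ( −3 · ((1/2)_n)² / ((2)_n)² + 4 · (1/2)_n (7/6)_n / ( (2)_n (4/3)_n ) − (1/2)_n (5/6)_n / ( (2)_n (5/3)_n ) ). -/

import Mathlib

/-- Square-lattice steps. -/
def squareSteps : Set (ℤ × ℤ) := {(1,0), (-1,0), (0,1), (0,-1)}

/-- Diagonal-lattice steps. -/
def diagSteps : Set (ℤ × ℤ) := {(1,1), (1,-1), (-1,1), (-1,-1)}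

/-- The three-quadrant cone `C = {(i,j) : i ≥ 0 or j ≥ 0}`. -/
def coneC : Set (ℤ × ℤ) := {p | 0 ≤ p.1 ∨ 0 ≤ p.2}

/-- The quadrant `Q = {(i,j) : i ≥ 0 and j ≥ 0}`. -/
def quadQ : Set (ℤ × ℤ) := {p | 0 ≤ p.1 ∧ 0 ≤ p.2}

/-- Number of walks of length `n` with steps in `steps`, from `a` to `b`,
confined to `region`. -/
noncomputable def walkCount (steps region : Set (ℤ × ℤ)) (a b : ℤ × ℤ) (n : ℕ) : ℕ :=
  Nat.card {w : Fin (n+1) → ℤ × ℤ //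
    w 0 = a ∧ w (Fin.last n) = b ∧
    (∀ k : Fin n, w k.succ - w k.castSucc ∈ steps) ∧
    (∀ k, w k ∈ region)}

/-- Ascending factorial (Pochhammer symbol) `(a)ₙ = a(a+1)⋯(a+n-1)`. -/
noncomputable def poch (a : ℚ) (n : ℕ) : ℚ := (ascPochhammer ℚ n).eval a

theorem finite_walks (S : Finset (ℤ × ℤ)) (region : Set (ℤ × ℤ)) (a b : ℤ × ℤ) (n : ℕ) :
    Finite {w : Fin (n+1) → ℤ × ℤ //
      w 0 = a ∧ w (Fin.last n) = b ∧
      (∀ k : Fin n, w k.succ - w k.castSucc ∈ (S : Set (ℤ × ℤ))) ∧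
      (∀ k, w k ∈ region)} := by
  refine Finite.of_injective (β := Fin n → S)
    (fun w k => ⟨w.1 k.succ - w.1 k.castSucc, w.2.2.2.1 k⟩) ?_
  rintro ⟨v, hv, _⟩ ⟨w, hw, _⟩ h
  refine Subtype.ext (funext fun k => ?_)
  induction k using Fin.induction with
  | zero => exact hv.trans hw.symm
  | succ k ih =>
    have := congrArg Subtype.val (congrFun h k)
    simp only at this ih
    rwa [ih, sub_left_inj] at this

theorem walkCount_succ (S : Finset (ℤ × ℤ)) (region : Set (ℤ × ℤ)) (a b : ℤ × ℤ) (n : ℕ)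
    (hb : b ∈ region) :
    walkCount S region a b (n + 1) = ∑ s ∈ S, walkCount S region a (b - s) n := by
  rw [← Finset.sum_coe_sort S (fun s => walkCount S region a (b - s) n)]
  unfold walkCount
  have := fun s : S => finite_walks S region a (b - s) n
  rw [← Nat.card_sigma]
  refine Nat.card_congr
    { toFun := fun w => ⟨⟨w.1 (Fin.last n).succ - w.1 (Fin.last n).castSucc, w.2.2.2.1 _⟩,
        ⟨fun k => w.1 k.castSucc, w.2.1, ?_, fun k => w.2.2.2.1 k.castSucc, fun k => w.2.2.2.2 _⟩⟩
      invFun := fun x => ⟨Fin.snoc (α := fun _ => ℤ × ℤ) x.2.1 b, ?_, ?_, ?_, ?_⟩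
      left_inv := ?_
      right_inv := ?_ }
  · simp [w.2.2.1]
  · exact (Fin.snoc_castSucc (α := fun _ => ℤ × ℤ) b x.2.1 0).trans x.2.2.1
  · simp
  · intro k
    refine Fin.lastCases ?_ (fun k => ?_) k
    · rw [Fin.succ_last, Fin.snoc_last, Fin.snoc_castSucc, x.2.2.2.1]
      simp
    · rw [← Fin.castSucc_succ, Fin.snoc_castSucc, Fin.snoc_castSucc]
      exact x.2.2.2.2.1 k
  · intro k
    refine Fin.lastCases ?_ (fun k => ?_) k
    · simpa using hb
    · rw [Fin.snoc_castSucc]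
      exact x.2.2.2.2.2 k
  · rintro ⟨w, h0, h1, h2, h3⟩
    refine Subtype.ext (funext fun k => ?_)
    refine Fin.lastCases ?_ (fun k => ?_) k
    · simp [h1]
    · simp
  · rintro ⟨s, w⟩
    have sigma_ext : ∀ x : (s : S) × {w : Fin (n+1) → ℤ × ℤ // w 0 = a ∧ w (Fin.last n) = b - s ∧
        (∀ k : Fin n, w k.succ - w k.castSucc ∈ (S : Set (ℤ × ℤ))) ∧ (∀ k, w k ∈ region)},
        x.1 = s → x.2.1 = w.1 → x = ⟨s, w⟩ := by
      rintro ⟨t, v⟩ rfl h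
      exact congrArg _ (Subtype.ext h)
    refine sigma_ext _ (Subtype.ext ?_) (funext fun k => ?_)
    · simp only [Fin.succ_last, Fin.snoc_last, Fin.snoc_castSucc, w.2.2.1, sub_sub_cancel]
    · simp only [Fin.snoc_castSucc]

theorem walkCount_eq_zero {steps region : Set (ℤ × ℤ)} {a b : ℤ × ℤ} (n : ℕ)
    (hb : b ∉ region) : walkCount steps region a b n = 0 := by
  unfold walkCount
  have : IsEmpty {w : Fin (n+1) → ℤ × ℤ // w 0 = a ∧ w (Fin.last n) = b ∧
      (∀ k : Fin n, w k.succ - w k.castSucc ∈ steps) ∧ (∀ k, w k ∈ region)} :=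
    ⟨fun w => hb (w.2.2.1 ▸ w.2.2.2.2 _)⟩
  exact Nat.card_of_isEmpty

theorem walkCount_zero {steps region : Set (ℤ × ℤ)} {a b : ℤ × ℤ} (ha : a ∈ region) :
    walkCount steps region a b 0 = if a = b then 1 else 0 := by
  unfold walkCount
  split_ifs with h
  · subst h
    refine Nat.card_eq_one_iff_unique.2 ⟨⟨?_⟩, ⟨⟨fun _ => a, rfl, rfl, fun k => k.elim0, fun _ => ha⟩⟩⟩
    rintro ⟨v, hv, -⟩ ⟨w, hw, -⟩
    refine Subtype.ext (funext fun k => ?_)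
    obtain rfl : k = 0 := Fin.fin_one_eq_zero k
    exact hv.trans hw.symm
  · have : IsEmpty {w : Fin (0+1) → ℤ × ℤ // w 0 = a ∧ w (Fin.last 0) = b ∧
        (∀ k : Fin 0, w k.succ - w k.castSucc ∈ steps) ∧ (∀ k, w k ∈ region)} :=
      ⟨fun w => h (w.2.1.symm.trans w.2.2.1)⟩
    exact Nat.card_of_isEmpty

/-- The number of walks from the origin to `(i, j)` in the three-quadrant cone. -/
noncomputable def coneWalks (n : ℕ) (i j : ℤ) : ℤ := walkCount diagSteps coneC (0, 0) (i, j) n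

theorem coneWalks_succ (n : ℕ) {i j : ℤ} (h : 0 ≤ i ∨ 0 ≤ j) :
    coneWalks (n + 1) i j = coneWalks n (i - 1) (j - 1) + coneWalks n (i - 1) (j + 1) +
      coneWalks n (i + 1) (j - 1) + coneWalks n (i + 1) (j + 1) := by
  have hS : diagSteps = ((({(1,1), (1,-1), (-1,1), (-1,-1)} : Finset (ℤ × ℤ)) :) : Set (ℤ × ℤ)) := by
    simp [diagSteps]
  unfold coneWalks
  rw [hS, walkCount_succ _ _ _ _ _ h]
  simp [Finset.sum_insert, add_assoc]

theorem coneWalks_of_neg (n : ℕ) {i j : ℤ} (hi : i < 0) (hj : j < 0) : coneWalks n i j = 0 := by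
  unfold coneWalks
  rw [walkCount_eq_zero n (by simp [coneC, hi, hj]), Nat.cast_zero]

theorem coneWalks_zero (i j : ℤ) : coneWalks 0 i j = if i = 0 ∧ j = 0 then 1 else 0 := by
  unfold coneWalks
  rw [walkCount_zero (by simp [coneC])]
  simp [eq_comm]

/-- Signed number of one-dimensional simple walks, reflected at `-1`. -/
def reflWalks : ℕ → ℤ → ℤ
  | 0, i => if i = 0 then 1 else if i = -2 then -1 else 0
  | n + 1, i => reflWalks n (i - 1) + reflWalks n (i + 1)

theorem reflWalks_reflect (n : ℕ) (i : ℤ) : reflWalks n (-2 - i) = - reflWalks n i := by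
  induction n generalizing i with
  | zero => simp only [reflWalks]; split_ifs <;> omega
  | succ n ih =>
    simp only [reflWalks]
    rw [show -2 - i - 1 = -2 - (i + 1) by ring, show -2 - i + 1 = -2 - (i - 1) by ring, ih, ih]
    ring

theorem reflWalks_neg_one (n : ℕ) : reflWalks n (-1) = 0 := by
  have := reflWalks_reflect n (-1)
  norm_num at this
  omega

theorem reflWalks_of_lt (n : ℕ) {i : ℤ} (h : n < i) : reflWalks n i = 0 := by
  induction n generalizing i with
  | zero => simp only [reflWalks]; split_ifs <;> omega
  | succ n ih =>
    push_cast at h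
    simp only [reflWalks]
    rw [ih (by omega), ih (by omega), add_zero]

theorem reflWalks_eq_choose (n k : ℕ) : reflWalks n (n - 2 * k) =
    (n.choose k : ℤ) - (if k = 0 then 0 else (n.choose (k - 1) : ℤ)) := by
  induction n generalizing k with
  | zero =>
    rcases k with _ | _ | k <;> simp [reflWalks, Nat.choose_eq_zero_of_lt]
    omega
  | succ n ih =>
    simp only [reflWalks]
    push_cast
    rw [show (n : ℤ) + 1 - 2 * k - 1 = n - 2 * k by ring, ih]
    rcases k with _ | k
    · rw [reflWalks_of_lt n (by push_cast; omega)]; simp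
    · rw [show (n : ℤ) + 1 - 2 * ((k + 1 : ℕ) : ℤ) + 1 = n - 2 * k by push_cast; ring, ih]
      rcases k with _ | k
      · simp
      · simp [Nat.choose_succ_succ']; ring

theorem reflWalks_two_mul (n : ℕ) : reflWalks (2 * n) 0 = catalan n := by
  have h := reflWalks_eq_choose (2 * n) n
  rw [show (((2 * n : ℕ) : ℤ) - 2 * n) = 0 by push_cast; ring] at h
  rw [h]
  rcases n with _ | n
  · simp
  · have h1 := succ_mul_catalan_eq_centralBinom (n + 1)
    have h2 := Nat.choose_succ_right_eq (2 * (n + 1)) n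
    rw [Nat.centralBinom_eq_two_mul_choose] at h1
    rw [show 2 * (n + 1) - n = n + 2 by omega] at h2
    have h1' : ((n : ℤ) + 2) * catalan (n + 1) = (2 * (n + 1)).choose (n + 1) := by
      rw [← h1]; push_cast; ring
    have h2' : ((2 * (n + 1)).choose (n + 1) : ℤ) * (n + 1) = (2 * (n + 1)).choose n * (n + 2) := by
      exact_mod_cast h2
    have h3 : ((n : ℤ) + 2) ≠ 0 := by positivity
    apply mul_left_cancel₀ h3
    simp only [Nat.add_sub_cancel, Nat.add_eq_zero_iff, one_ne_zero, and_false, if_false]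
    linear_combination (-1 : ℤ) * h1' + h2'

/-- Three times the walk count in the cone, corrected by a reflection solution
that vanishes on the boundary lines `i = -1` and `j = -1`. -/
noncomputable def corrWalks (n : ℕ) (i j : ℤ) : ℤ :=
  if 0 ≤ i ∨ 0 ≤ j then 3 * coneWalks n i j - reflWalks n i * reflWalks n j else 0

theorem corrWalks_eq (n : ℕ) {i j : ℤ} (h : -1 ≤ i ∨ -1 ≤ j) :
    corrWalks n i j = 3 * coneWalks n i j - reflWalks n i * reflWalks n j := by
  unfold corrWalks
  split_ifs with h'
  · rfl
  · push Not at h'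
    rw [coneWalks_of_neg n h'.1 h'.2]
    rcases h with h | h
    · rw [show i = -1 by omega, reflWalks_neg_one]; ring
    · rw [show j = -1 by omega, reflWalks_neg_one]; ring

theorem corrWalks_of_neg (n : ℕ) {i j : ℤ} (hi : i < 0) (hj : j < 0) : corrWalks n i j = 0 := by
  unfold corrWalks
  rw [if_neg (by omega)]

theorem corrWalks_succ (n : ℕ) {i j : ℤ} (h : 0 ≤ i ∨ 0 ≤ j) :
    corrWalks (n + 1) i j = corrWalks n (i - 1) (j - 1) + corrWalks n (i - 1) (j + 1) +
      corrWalks n (i + 1) (j - 1) + corrWalks n (i + 1) (j + 1) := by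
  rw [corrWalks_eq (n + 1) (by omega), corrWalks_eq n (by omega), corrWalks_eq n (by omega),
    corrWalks_eq n (by omega), corrWalks_eq n (by omega), coneWalks_succ n h]
  simp only [reflWalks]
  ring

theorem corrWalks_zero (i j : ℤ) : corrWalks 0 i j =
    if i = 0 ∧ j = 0 then 2 else if (i = 0 ∧ j = -2) ∨ (i = -2 ∧ j = 0) then 1 else 0 := by
  by_cases hi : i = 0 <;> by_cases hi' : i = -2 <;> by_cases hj : j = 0 <;>
    by_cases hj' : j = -2 <;> simp_all [corrWalks, coneWalks_zero, reflWalks]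

theorem corrWalks_symm (n : ℕ) (i j : ℤ) : corrWalks n i j = corrWalks n j i := by
  induction n generalizing i j with
  | zero => simp only [corrWalks_zero]; split_ifs <;> omega
  | succ n ih =>
    by_cases h : 0 ≤ i ∨ 0 ≤ j
    · rw [corrWalks_succ n h, corrWalks_succ n h.symm, ih (i - 1), ih (i - 1), ih (i + 1),
        ih (i + 1)]
      ring
    · rw [corrWalks_of_neg _ (by omega) (by omega), corrWalks_of_neg _ (by omega) (by omega)]

theorem corrWalks_of_lt (n : ℕ) {i j : ℤ} (h : n < i) : corrWalks n i j = 0 := by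
  induction n generalizing i j with
  | zero => rw [corrWalks_zero]; split_ifs <;> omega
  | succ n ih =>
    push_cast at h
    rw [corrWalks_succ n (by omega), ih (by omega), ih (by omega), ih (by omega), ih (by omega)]
    rfl

/-- The corrected counts in coordinates adapted to the half cone `j ≤ i`, graded so that the
length of the walk is `a + 2 * m`. -/
noncomputable def halfCone (a b m : ℕ) : ℚ := corrWalks (a + 2 * m) a (a - 2 * b)

theorem halfCone_zero_zero (b : ℕ) :
    halfCone 0 b 0 = if b = 0 then 2 else if b = 1 then 1 else 0 := by
  have : (halfCone 0 b 0 : ℚ) = (corrWalks 0 0 (-2 * b) : ℤ) := by simp [halfCone]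
  rw [this, corrWalks_zero]
  rcases b with _ | _ | b
  · simp
  · simp
  · rw [if_neg (by push_cast; omega), if_neg (by push_cast; omega), if_neg (by omega),
      if_neg (by omega), Int.cast_zero]

theorem halfCone_zero_succ_succ (b m : ℕ) :
    halfCone 0 (b + 1) (m + 1) = halfCone 1 (b + 1) m + halfCone 1 (b + 2) m := by
  simp only [halfCone]
  rw [show 0 + 2 * (m + 1) = 1 + 2 * m + 1 by ring, corrWalks_succ _ (by simp)]
  rw [corrWalks_of_neg _ (by simp) (by push_cast; omega),
    corrWalks_of_neg _ (by simp) (by push_cast; omega)]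
  push_cast
  ring_nf

theorem halfCone_zero_zero_succ (m : ℕ) :
    halfCone 0 0 (m + 1) = halfCone 1 0 m + 2 * halfCone 1 1 m := by
  simp only [halfCone]
  rw [show 0 + 2 * (m + 1) = 1 + 2 * m + 1 by ring, corrWalks_succ _ (by simp)]
  rw [corrWalks_of_neg _ (by simp) (by simp), corrWalks_symm _ (_ - _) (_ + _)]
  push_cast
  ring_nf

theorem halfCone_succ_succ_zero (a b : ℕ) :
    halfCone (a + 1) (b + 1) 0 = halfCone a b 0 + halfCone a (b + 1) 0 := by
  simp only [halfCone]
  rw [show a + 1 + 2 * 0 = a + 2 * 0 + 1 by ring, corrWalks_succ _ (by left; positivity)]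
  rw [corrWalks_of_lt (i := _ + 1) _ (by push_cast; omega),
    corrWalks_of_lt (i := _ + 1) _ (by push_cast; omega)]
  push_cast
  ring_nf

theorem halfCone_succ_zero_zero (a : ℕ) : halfCone (a + 1) 0 0 = halfCone a 0 0 := by
  simp only [halfCone]
  rw [show a + 1 + 2 * 0 = a + 2 * 0 + 1 by ring, corrWalks_succ _ (by left; positivity)]
  rw [corrWalks_of_lt (i := _ + 1) _ (by push_cast; omega),
    corrWalks_of_lt (i := _ + 1) _ (by push_cast; omega), corrWalks_symm _ (_ - _) (_ + _),
    corrWalks_of_lt (i := _ + 1) _ (by push_cast; omega)]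
  push_cast
  ring_nf

theorem halfCone_succ_succ_succ (a b m : ℕ) :
    halfCone (a + 1) (b + 1) (m + 1) = halfCone a b (m + 1) + halfCone a (b + 1) (m + 1) +
      halfCone (a + 2) (b + 1) m + halfCone (a + 2) (b + 2) m := by
  simp only [halfCone]
  rw [show a + 1 + 2 * (m + 1) = a + 2 * (m + 1) + 1 by ring, corrWalks_succ _ (by left; positivity)]
  rw [show a + 2 + 2 * m = a + 2 * (m + 1) by ring]
  push_cast
  ring_nf

theorem halfCone_succ_zero_succ (a m : ℕ) :
    halfCone (a + 1) 0 (m + 1) = halfCone a 0 (m + 1) +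
      halfCone (a + 2) 0 m + 2 * halfCone (a + 2) 1 m := by
  simp only [halfCone]
  rw [show a + 1 + 2 * (m + 1) = a + 2 * (m + 1) + 1 by ring, corrWalks_succ _ (by left; positivity),
    corrWalks_symm _ (_ - _) (_ + _)]
  rw [show a + 2 + 2 * m = a + 2 * (m + 1) by ring]
  push_cast
  ring_nf

theorem walkCount_eq_halfCone (n : ℕ) : (walkCount diagSteps coneC (0, 0) (-2, 0) (2 * n) : ℚ) =
    (halfCone 0 1 n - (catalan n : ℚ) ^ 2) / 3 := by
  have h1 : corrWalks (2 * n) (-2) 0 = _ := corrWalks_eq (2 * n) (by norm_num)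
  have h2 := reflWalks_reflect (2 * n) 0
  rw [sub_zero] at h2
  rw [h2, reflWalks_two_mul] at h1
  have h3 : halfCone 0 1 n = corrWalks (2 * n) (-2) 0 := by
    rw [corrWalks_symm]
    simp [halfCone]
  rw [h3, h1, coneWalks]
  push_cast
  ring

section PowerSeriesTools

open MvPowerSeries

variable {σ τ υ : Type*}

/-- Substitution of power series without constant term, as an algebra homomorphism. -/
noncomputable def substHom [Finite σ] (a : σ → MvPowerSeries τ ℚ)
    (ha : ∀ s, constantCoeff (a s) = 0) : MvPowerSeries σ ℚ →ₐ[ℚ] MvPowerSeries τ ℚ :=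
  substAlgHom (hasSubst_of_constantCoeff_zero ha)

@[simp]
theorem substHom_X [Finite σ] (a : σ → MvPowerSeries τ ℚ) (ha : ∀ s, constantCoeff (a s) = 0)
    (s : σ) : substHom a ha (X s) = a s :=
  substAlgHom_X _ s

theorem substHom_substHom [Finite σ] [Finite τ] (a : σ → MvPowerSeries τ ℚ)
    (ha : ∀ s, constantCoeff (a s) = 0) (b : τ → MvPowerSeries υ ℚ)
    (hb : ∀ s, constantCoeff (b s) = 0) (c : σ → MvPowerSeries υ ℚ)
    (hc : ∀ s, constantCoeff (c s) = 0) (h : ∀ s, substHom b hb (a s) = c s)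
    (f : MvPowerSeries σ ℚ) : substHom b hb (substHom a ha f) = substHom c hc f := by
  simp only [substHom] at h ⊢
  rw [substAlgHom_comp_substAlgHom_apply]
  congr 2
  ext1 s
  rw [← h, substAlgHom_apply]

theorem constantCoeff_substHom [Finite σ] (a : σ → MvPowerSeries τ ℚ)
    (ha : ∀ s, constantCoeff (a s) = 0) (f : MvPowerSeries σ ℚ) :
    constantCoeff (substHom a ha f) = constantCoeff f := by
  have h : constantCoeff (f - C (constantCoeff f)) = 0 := by simp
  have := constantCoeff_subst_eq_zero (hasSubst_of_constantCoeff_zero ha) ha h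
  rw [← coe_substAlgHom (hasSubst_of_constantCoeff_zero ha), map_sub, map_sub, sub_eq_zero] at this
  refine this.trans ?_
  rw [MvPowerSeries.c_eq_algebraMap, AlgHom.commutes, ← MvPowerSeries.c_eq_algebraMap]
  simp

theorem constantCoeff_update_X [DecidableEq σ] (s t : σ) :
    constantCoeff (Function.update X s 0 t : MvPowerSeries σ ℚ) = 0 := by
  by_cases h : t = s
  · subst h; simp
  · simp [Function.update_of_ne h]

/-- Setting one variable to zero. -/
noncomputable def killVar [Finite σ] [DecidableEq σ] (s : σ) :
    MvPowerSeries σ ℚ →ₐ[ℚ] MvPowerSeries σ ℚ :=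
  substHom (Function.update X s 0) (constantCoeff_update_X s)

theorem killVar_X_self [Finite σ] [DecidableEq σ] (s : σ) : killVar s (X s) = 0 := by
  simp [killVar]

theorem killVar_X_of_ne [Finite σ] [DecidableEq σ] {s t : σ} (h : t ≠ s) :
    killVar s (X t) = X t := by
  simp [killVar, h]

theorem coeff_killVar [Finite σ] [DecidableEq σ] (s : σ) (f : MvPowerSeries σ ℚ) (m : σ →₀ ℕ) :
    coeff m (killVar s f) = if m s = 0 then coeff m f else 0 := by
  have key : ∀ d : σ →₀ ℕ, (d.prod fun t e => (Function.update X s 0 t : MvPowerSeries σ ℚ) ^ e) =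
      if d s = 0 then monomial d 1 else 0 := by
    intro d
    split_ifs with h
    · rw [monomial_one_eq]
      refine Finsupp.prod_congr fun t ht => ?_
      rw [Function.update_of_ne]
      rintro rfl
      exact (Finsupp.mem_support_iff.1 ht) h
    · rw [Finsupp.prod]
      refine Finset.prod_eq_zero (Finsupp.mem_support_iff.2 h) ?_
      simp [h]
  rw [killVar, substHom, substAlgHom_apply, coeff_subst (hasSubst_of_constantCoeff_zero (constantCoeff_update_X s)),
    finsum_eq_single _ m]
  · rw [key]
    split_ifs <;> simp
  · intro d hd
    rw [key]
    split_ifs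
    · rw [coeff_monomial_ne hd.symm, smul_zero]
    · simp

theorem X_dvd_sub_killVar [Finite σ] [DecidableEq σ] (s : σ) (f : MvPowerSeries σ ℚ) :
    X s ∣ f - killVar s f := by
  rw [X_dvd_iff]
  intro m hm
  simp [coeff_killVar, hm]

theorem X_dvd_iff_killVar [Finite σ] [DecidableEq σ] (s : σ) (f : MvPowerSeries σ ℚ) :
    X s ∣ f ↔ killVar s f = 0 := by
  constructor
  · rintro ⟨g, rfl⟩
    rw [map_mul, killVar_X_self, zero_mul]
  · intro h
    simpa [h] using X_dvd_sub_killVar s f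

theorem constantCoeff_killVar [Finite σ] [DecidableEq σ] (s : σ) (f : MvPowerSeries σ ℚ) :
    constantCoeff (killVar s f) = constantCoeff f :=
  constantCoeff_substHom _ _ f

/-- A self-map of a power series ring that is a contraction for the adic topology of a variable
has a fixed point. -/
theorem exists_fixed_of_contraction (s : σ)
    (f : MvPowerSeries σ ℚ → MvPowerSeries σ ℚ)
    (hf : ∀ x y, X s * (x - y) ∣ f x - f y) : ∃ x, f x = x := by
  have step : ∀ k x y, (X s) ^ k ∣ x - y → (X s) ^ (k + 1) ∣ f x - f y := fun k x y h =>
    by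
    rw [pow_succ']
    exact (mul_dvd_mul_left (X s) h).trans (hf x y)
  have iter : ∀ k, (X s) ^ k ∣ f^[k + 1] 0 - f^[k] 0 := by
    intro k
    induction k with
    | zero => simp
    | succ k ih =>
      rw [Function.iterate_succ_apply' f (k + 1), Function.iterate_succ_apply' f k]
      exact step k _ _ (by rwa [← Function.iterate_succ_apply' f k])
  have iter_add : ∀ k j, (X s) ^ k ∣ f^[k + j] 0 - f^[k] 0 := by
    intro k j
    induction j with
    | zero => simp
    | succ j ih =>
      have := dvd_add ((pow_dvd_pow (X s) (Nat.le_add_right k j)).trans (iter (k + j))) ih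
      rwa [sub_add_sub_cancel] at this
  let x : MvPowerSeries σ ℚ := fun m => coeff m (f^[m s + 1] 0)
  have hx : ∀ k, (X s) ^ k ∣ x - f^[k] 0 := by
    intro k
    rw [X_pow_dvd_iff]
    intro m hm
    obtain ⟨j, rfl⟩ : ∃ j, k = m s + 1 + j := ⟨k - (m s + 1), by omega⟩
    have := (X_pow_dvd_iff.1 (iter_add (m s + 1) j)) m (Nat.lt_succ_self _)
    rw [map_sub, sub_eq_zero] at this ⊢
    exact this.symm
  refine ⟨x, ?_⟩
  rw [← sub_eq_zero]
  ext m
  have h1 := (pow_dvd_pow (X s) (Nat.le_succ (m s + 1))).trans (step _ _ _ (hx (m s + 1)))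
  rw [← Function.iterate_succ_apply' f] at h1
  have h2 := (pow_dvd_pow (X s) (Nat.le_succ (m s + 1))).trans (hx (m s + 1 + 1))
  have := dvd_sub h1 h2
  rw [sub_sub_sub_cancel_right] at this
  exact X_pow_dvd_iff.1 this m (Nat.lt_succ_self _)

end PowerSeriesTools

section HalfConeSeries

open MvPowerSeries

/-- The three-variable power series with given coefficients. -/
def series3 (f : ℕ → ℕ → ℕ → ℚ) : MvPowerSeries (Fin 3) ℚ := fun m => f (m 0) (m 1) (m 2)

theorem coeff_series3 (f : ℕ → ℕ → ℕ → ℚ) (m : Fin 3 →₀ ℕ) :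
    coeff m (series3 f) = f (m 0) (m 1) (m 2) := rfl

theorem coeff_X_mul_eq {σ : Type*} [DecidableEq σ] (s : σ) (f : MvPowerSeries σ ℚ) (m : σ →₀ ℕ) :
    coeff m (X s * f) = if m s = 0 then 0 else coeff (m - Finsupp.single s 1) f := by
  rw [X, coeff_monomial_mul, one_mul]
  by_cases h : m s = 0
  · rw [if_pos h, if_neg]
    intro h'
    simpa [h] using h' s
  · rw [if_neg h, if_pos]
    rw [Finsupp.single_le_iff]
    omega

theorem X_zero_mul_series3 (f : ℕ → ℕ → ℕ → ℚ) :
    X 0 * series3 f = series3 fun a b m => if a = 0 then 0 else f (a - 1) b m := by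
  ext m
  simp [coeff_X_mul_eq, coeff_series3]

theorem X_one_mul_series3 (f : ℕ → ℕ → ℕ → ℚ) :
    X 1 * series3 f = series3 fun a b m => if b = 0 then 0 else f a (b - 1) m := by
  ext m
  simp [coeff_X_mul_eq, coeff_series3]

theorem X_two_mul_series3 (f : ℕ → ℕ → ℕ → ℚ) :
    X 2 * series3 f = series3 fun a b m => if m = 0 then 0 else f a b (m - 1) := by
  ext m
  simp [coeff_X_mul_eq, coeff_series3]

theorem killVar_zero_series3 (f : ℕ → ℕ → ℕ → ℚ) :
    killVar 0 (series3 f) = series3 fun a b m => if a = 0 then f a b m else 0 := by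
  ext m
  simp [coeff_killVar, coeff_series3]

theorem killVar_one_series3 (f : ℕ → ℕ → ℕ → ℚ) :
    killVar 1 (series3 f) = series3 fun a b m => if b = 0 then f a b m else 0 := by
  ext m
  simp [coeff_killVar, coeff_series3]

theorem series3_add (f g : ℕ → ℕ → ℕ → ℚ) :
    series3 f + series3 g = series3 fun a b m => f a b m + g a b m := rfl

theorem one_eq_series3 :
    (1 : MvPowerSeries (Fin 3) ℚ) =
      series3 fun a b m => if a = 0 ∧ b = 0 ∧ m = 0 then 1 else 0 := by
  classical
  ext m
  rw [coeff_one, coeff_series3]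
  congr 1
  simp [Finsupp.ext_iff, Fin.forall_fin_succ]

theorem series3_congr {f g : ℕ → ℕ → ℕ → ℚ} (h : ∀ a b m, f a b m = g a b m) :
    series3 f = series3 g :=
  congrArg series3 (funext fun a => funext fun b => funext fun m => h a b m)

/-- The generating function of `halfCone`. -/
noncomputable def hcSeries : MvPowerSeries (Fin 3) ℚ := series3 halfCone

/-- The generating function of `halfCone` off the axis `b = 0`. -/
noncomputable def hcSeriesPos : MvPowerSeries (Fin 3) ℚ :=
  series3 fun a b m => halfCone a (b + 1) m

theorem hcSeries_eq : hcSeries = killVar 1 hcSeries + X 1 * hcSeriesPos := by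
  rw [hcSeries, hcSeriesPos, killVar_one_series3, X_one_mul_series3, series3_add]
  refine series3_congr fun a b m => ?_
  rcases b with _ | b <;> simp

theorem hcSeriesPos_recurrence :
    X 0 * X 1 * hcSeriesPos = X 0 ^ 2 * X 1 * (hcSeries + hcSeriesPos) +
      X 1 * X 2 * (hcSeriesPos - killVar 0 hcSeriesPos) +
      X 2 * (hcSeriesPos - killVar 1 hcSeriesPos - killVar 0 hcSeriesPos +
        killVar 0 (killVar 1 hcSeriesPos)) + X 0 * X 1 := by
  have h1 : hcSeriesPos = X 0 * (hcSeries + hcSeriesPos) +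
      X 2 * (series3 (fun a b m => halfCone (a + 1) (b + 1) m) +
        series3 fun a b m => halfCone (a + 1) (b + 2) m) + 1 := by
    rw [hcSeries, hcSeriesPos, series3_add, series3_add, X_zero_mul_series3, X_two_mul_series3,
      one_eq_series3, series3_add, series3_add]
    refine series3_congr fun a b m => ?_
    rcases a with _ | a <;> rcases m with _ | m
    · rcases b with _ | b <;> simp [halfCone_zero_zero]
    · simp [halfCone_zero_succ_succ]
    · simp [halfCone_succ_succ_zero]
    · simp [halfCone_succ_succ_succ]
      ring
  have h2 : X 0 * series3 (fun a b m => halfCone (a + 1) (b + 1) m) +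
      killVar 0 hcSeriesPos = hcSeriesPos := by
    rw [hcSeriesPos, killVar_zero_series3, X_zero_mul_series3, series3_add]
    refine series3_congr fun a b m => ?_
    rcases a with _ | a <;> simp
  have h3 : X 0 * (X 1 * series3 (fun a b m => halfCone (a + 1) (b + 2) m)) +
      killVar 1 hcSeriesPos + killVar 0 hcSeriesPos =
        hcSeriesPos + killVar 0 (killVar 1 hcSeriesPos) := by
    rw [hcSeriesPos, killVar_zero_series3, killVar_one_series3, killVar_zero_series3,
      X_one_mul_series3, X_zero_mul_series3, series3_add, series3_add, series3_add]
    refine series3_congr fun a b m => ?_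
    rcases a with _ | a <;> rcases b with _ | b <;> simp
  linear_combination (X 0 * X 1) * h1 + (X 1 * X 2) * h2 + X 2 * h3

theorem killVar_hcSeries_recurrence :
    X 0 * killVar 1 hcSeries = 2 * X 0 + X 0 ^ 2 * killVar 1 hcSeries +
      X 2 * (killVar 1 hcSeries - killVar 0 (killVar 1 hcSeries)) +
      2 * X 2 * (killVar 1 hcSeriesPos - killVar 0 (killVar 1 hcSeriesPos)) := by
  have h1 : killVar 1 hcSeries = X 0 * killVar 1 hcSeries +
      X 2 * (series3 (fun a b m => if b = 0 then halfCone (a + 1) 0 m else 0) +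
        (series3 (fun a b m => if b = 0 then halfCone (a + 1) 1 m else 0) +
         series3 (fun a b m => if b = 0 then halfCone (a + 1) 1 m else 0))) + (1 + 1) := by
    rw [hcSeries, killVar_one_series3, series3_add, series3_add, X_zero_mul_series3,
      X_two_mul_series3, one_eq_series3, series3_add, series3_add, series3_add]
    refine series3_congr fun a b m => ?_
    rcases b with _ | b
    · rcases a with _ | a <;> rcases m with _ | m
      · simp [halfCone_zero_zero]; norm_num
      · simp [halfCone_zero_zero_succ]; ring
      · simp [halfCone_succ_zero_zero]
      · simp [halfCone_succ_zero_succ]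
        ring
    · simp
  have h2 : X 0 * series3 (fun a b m => if b = 0 then halfCone (a + 1) 0 m else 0) +
      killVar 0 (killVar 1 hcSeries) = killVar 1 hcSeries := by
    rw [hcSeries, killVar_one_series3, killVar_zero_series3, X_zero_mul_series3, series3_add]
    refine series3_congr fun a b m => ?_
    rcases a with _ | a <;> rcases b with _ | b <;> simp
  have h3 : X 0 * series3 (fun a b m => if b = 0 then halfCone (a + 1) 1 m else 0) +
      killVar 0 (killVar 1 hcSeriesPos) = killVar 1 hcSeriesPos := by
    rw [hcSeriesPos, killVar_one_series3, killVar_zero_series3, X_zero_mul_series3, series3_add]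
    refine series3_congr fun a b m => ?_
    rcases a with _ | a <;> rcases b with _ | b <;> simp
  linear_combination X 0 * h1 + X 2 * h2 + 2 * X 2 * h3

/-- The substitution for the third variable that annihilates the kernel. -/
noncomputable def kernelRoot : MvPowerSeries (Fin 2) ℚ :=
  X 0 * X 1 * ((1 + X 1)⁻¹ - X 0)

theorem one_add_X_one_mul_kernelRoot :
    (1 + X 1) * kernelRoot = X 0 * X 1 - X 0 ^ 2 * X 1 * (1 + X 1) := by
  have h : (1 + X 1 : MvPowerSeries (Fin 2) ℚ) * (1 + X 1)⁻¹ = 1 :=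
    MvPowerSeries.mul_inv_cancel _ (by simp)
  rw [kernelRoot]
  linear_combination (X 0 * X 1) * h

theorem constantCoeff_kernelRoot : constantCoeff kernelRoot = 0 := by
  simp [kernelRoot]

/-- Substitution of the kernel root, keeping the first catalytic variable. -/
noncomputable def substU : MvPowerSeries (Fin 2) ℚ →ₐ[ℚ] MvPowerSeries (Fin 2) ℚ :=
  substHom ![X 0, kernelRoot] (by simp [Fin.forall_fin_two, constantCoeff_kernelRoot])

/-- Substitution of the kernel root, keeping the second catalytic variable. -/
noncomputable def substY : MvPowerSeries (Fin 2) ℚ →ₐ[ℚ] MvPowerSeries (Fin 2) ℚ :=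
  substHom ![X 1, kernelRoot] (by simp [Fin.forall_fin_two, constantCoeff_kernelRoot])

/-- The specialisation of a three-variable series to the first and third variable. -/
noncomputable def specU : MvPowerSeries (Fin 3) ℚ →ₐ[ℚ] MvPowerSeries (Fin 2) ℚ :=
  substHom ![X 0, 0, X 1] (by simp [Fin.forall_fin_succ])

/-- The specialisation of a three-variable series to the second and third variable. -/
noncomputable def specY : MvPowerSeries (Fin 3) ℚ →ₐ[ℚ] MvPowerSeries (Fin 2) ℚ :=
  substHom ![0, X 0, X 1] (by simp [Fin.forall_fin_succ])

/-- Substitution of the kernel root in a three-variable series. -/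
noncomputable def substKernel : MvPowerSeries (Fin 3) ℚ →ₐ[ℚ] MvPowerSeries (Fin 2) ℚ :=
  substHom ![X 0, X 1, kernelRoot] (by simp [Fin.forall_fin_succ, constantCoeff_kernelRoot])

theorem substKernel_killVar_one (f : MvPowerSeries (Fin 3) ℚ) :
    substKernel (killVar 1 f) = substU (specU f) := by
  have hc : ∀ s, constantCoeff (![X 0, 0, kernelRoot] s : MvPowerSeries (Fin 2) ℚ) = 0 := by
    simp [Fin.forall_fin_succ, constantCoeff_kernelRoot]
  rw [substKernel, killVar, substU, specU, substHom_substHom (hc := hc),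
    substHom_substHom (hc := hc)]
  · simp [Fin.forall_fin_succ]
  · simp [Fin.forall_fin_succ, Function.update_apply]

theorem substKernel_killVar_zero (f : MvPowerSeries (Fin 3) ℚ) :
    substKernel (killVar 0 f) = substY (specY f) := by
  have hc : ∀ s, constantCoeff (![0, X 1, kernelRoot] s : MvPowerSeries (Fin 2) ℚ) = 0 := by
    simp [Fin.forall_fin_succ, constantCoeff_kernelRoot]
  rw [substKernel, killVar, substY, specY, substHom_substHom (hc := hc),
    substHom_substHom (hc := hc)]
  · simp [Fin.forall_fin_succ]
  · simp [Fin.forall_fin_succ, Function.update_apply]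

/-- The kernel equation relating the two boundary series. -/
theorem kernel_equation :
    (1 - X 0 * (1 + X 1) ^ 2) * substU (2 + X 0 * specU hcSeries) =
      substY (2 - X 1 * (1 + X 0) * (2 * (1 + X 0) * specY hcSeriesPos +
        specY (killVar 1 hcSeries))) := by
  have h1 := congrArg substKernel hcSeries_eq
  have h2 := congrArg substKernel hcSeriesPos_recurrence
  have h3 := congrArg substKernel killVar_hcSeries_recurrence
  have X0 : substKernel (X 0) = X 0 := by simp [substKernel]
  have X1 : substKernel (X 1) = X 1 := by simp [substKernel]
  have X2 : substKernel (X 2) = kernelRoot := by simp [substKernel]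
  have U0 : substU (X 0) = X 0 := by simp [substU]
  have Y0 : substY (X 0) = X 1 := by simp [substY]
  have Y1 : substY (X 1) = kernelRoot := by simp [substY]
  simp only [map_add, map_sub, map_mul, map_pow, map_ofNat, substKernel_killVar_one,
    substKernel_killVar_zero, X0, X1, X2] at h1 h2 h3
  simp only [map_add, map_sub, map_mul, map_ofNat, map_one, U0, Y0, Y1]
  have hT := one_add_X_one_mul_kernelRoot
  linear_combination (1 + X 1) * (2 * h2 + h3 + 2 * X 0 ^ 2 * X 1 * h1) +
    (substU (specU hcSeries) + 2 * (1 + X 1) * substKernel hcSeriesPos) * hT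

end HalfConeSeries

section Uniqueness

open MvPowerSeries

theorem substU_X_zero : substU (X 0) = X 0 := by simp [substU]

theorem substU_X_one : substU (X 1) = kernelRoot := by simp [substU]

theorem substY_X_zero : substY (X 0) = X 1 := by simp [substY]

theorem substY_X_one : substY (X 1) = kernelRoot := by simp [substY]

theorem constantCoeff_substU (f : MvPowerSeries (Fin 2) ℚ) :
    constantCoeff (substU f) = constantCoeff f := constantCoeff_substHom _ _ f

theorem constantCoeff_substY (f : MvPowerSeries (Fin 2) ℚ) :
    constantCoeff (substY f) = constantCoeff f := constantCoeff_substHom _ _ f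

theorem ne_zero_of_constantCoeff {σ : Type*} {f : MvPowerSeries σ ℚ}
    (h : constantCoeff f ≠ 0) : f ≠ 0 := by
  rintro rfl
  simp at h

theorem X_ne_zero' {σ : Type*} (s : σ) : (X s : MvPowerSeries σ ℚ) ≠ 0 := by
  classical
  intro h
  have := congrArg (coeff (Finsupp.single s 1)) h
  simp [coeff_X] at this

theorem kernelRoot_ne_zero : kernelRoot ≠ 0 := by
  rw [kernelRoot]
  refine mul_ne_zero (mul_ne_zero (X_ne_zero' 0) (X_ne_zero' 1)) (ne_zero_of_constantCoeff ?_)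
  simp

theorem killVar_one_kernelRoot : killVar 1 kernelRoot = 0 := by
  rw [kernelRoot, map_mul, map_mul, killVar_X_self, mul_zero, zero_mul]

theorem killVar_one_substU (f : MvPowerSeries (Fin 2) ℚ) :
    killVar 1 (substU f) = killVar 1 f := by
  refine substHom_substHom _ _ _ _ _ _ (Fin.forall_fin_two.2 ⟨?_, ?_⟩) f
  · simp
  · exact killVar_one_kernelRoot.trans (by simp)

/-- Setting the first variable to zero and renaming the second one. -/
noncomputable def shiftVar : MvPowerSeries (Fin 2) ℚ →ₐ[ℚ] MvPowerSeries (Fin 2) ℚ :=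
  substHom ![0, X 0] (by simp [Fin.forall_fin_two])

theorem shiftVar_kernelRoot : shiftVar kernelRoot = 0 := by
  rw [kernelRoot, map_mul, map_mul]
  simp [shiftVar]

theorem shiftVar_substY (f : MvPowerSeries (Fin 2) ℚ) : shiftVar (substY f) = killVar 1 f := by
  refine substHom_substHom _ _ _ _ _ _ (Fin.forall_fin_two.2 ⟨?_, ?_⟩) f
  · simp
  · exact shiftVar_kernelRoot.trans (by simp)

theorem X_one_dvd_of_kernel_equation {P Q : MvPowerSeries (Fin 2) ℚ}
    (h : (1 + X 1) * (1 - X 0 * (1 + X 1) ^ 2) * substU P =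
      X 1 * (1 - X 0 * (1 + X 1)) * substY Q) : X 1 ∣ P ∧ X 1 ∣ Q := by
  have hP : killVar 1 P = 0 := by
    have := congrArg (killVar 1) h
    rw [map_mul, map_mul (killVar 1) (X 1 * _), map_mul (killVar 1) (X 1), killVar_X_self,
      zero_mul, zero_mul, killVar_one_substU] at this
    refine (mul_eq_zero.1 this).resolve_left (ne_zero_of_constantCoeff ?_)
    rw [constantCoeff_killVar]
    simp
  have hP' := (X_dvd_iff_killVar 1 P).2 hP
  refine ⟨hP', (X_dvd_iff_killVar 1 Q).2 ?_⟩
  obtain ⟨P', rfl⟩ := hP'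
  have := congrArg shiftVar h
  rw [map_mul substU, substU_X_one, map_mul, map_mul shiftVar kernelRoot, shiftVar_kernelRoot,
    zero_mul, mul_zero, map_mul, shiftVar_substY, map_mul] at this
  refine (mul_eq_zero.1 this.symm).resolve_left (mul_ne_zero ?_ (ne_zero_of_constantCoeff ?_))
  · simpa [shiftVar] using X_ne_zero' (0 : Fin 2)
  · rw [shiftVar, constantCoeff_substHom]
    simp

theorem eq_zero_of_kernel_equation {P Q : MvPowerSeries (Fin 2) ℚ}
    (h : (1 + X 1) * (1 - X 0 * (1 + X 1) ^ 2) * substU P =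
      X 1 * (1 - X 0 * (1 + X 1)) * substY Q) : P = 0 ∧ Q = 0 := by
  have key : ∀ k, X 1 ^ k ∣ P ∧ X 1 ^ k ∣ Q := by
    intro k
    induction k generalizing P Q with
    | zero => simp
    | succ k ih =>
      obtain ⟨⟨P', rfl⟩, ⟨Q', rfl⟩⟩ := X_one_dvd_of_kernel_equation h
      rw [map_mul, map_mul, substU_X_one, substY_X_one] at h
      rw [pow_succ']
      have := ih (P := P') (Q := Q') (mul_left_cancel₀ kernelRoot_ne_zero (by
        linear_combination h))
      exact ⟨mul_dvd_mul_left _ this.1, mul_dvd_mul_left _ this.2⟩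
  constructor
  · ext m
    exact X_pow_dvd_iff.1 (key (m 1 + 1)).1 m (Nat.lt_succ_self _)
  · ext m
    exact X_pow_dvd_iff.1 (key (m 1 + 1)).2 m (Nat.lt_succ_self _)

/-- A pair of normalised series is determined by the kernel equation. -/
theorem kernel_equation_unique {V W A B : MvPowerSeries (Fin 2) ℚ}
    (h : (1 - X 0 * (1 + X 1) ^ 2) * substU V = substY A)
    (h' : (1 - X 0 * (1 + X 1) ^ 2) * substU W = substY B)
    (hV : X 0 ∣ V - W) (hA : X 1 ∣ A - B) : V = W ∧ A = B := by
  obtain ⟨P, hP⟩ := hV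
  obtain ⟨Q, hQ⟩ := hA
  have hU := congrArg substU hP
  have hY := congrArg substY hQ
  rw [map_sub, map_mul, substU_X_zero] at hU
  rw [map_sub, map_mul, substY_X_one] at hY
  have := eq_zero_of_kernel_equation (P := P) (Q := Q) (mul_left_cancel₀ (X_ne_zero' (0 : Fin 2)) (by
    linear_combination (1 + X 1) * (h - h') - (1 + X 1) * (1 - X 0 * (1 + X 1) ^ 2) * hU +
      (1 + X 1) * hY + substY Q * one_add_X_one_mul_kernelRoot))
  rw [this.1, mul_zero, sub_eq_zero] at hP
  rw [this.2, mul_zero, sub_eq_zero] at hQ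
  exact ⟨hP, hQ⟩

end Uniqueness

section FieldIdentities

variable {K : Type*} [Field K]

theorem sum_mul_one_sub_sum {u y τ : K} (hu : u ≠ 0) (hy : y ≠ 0) (hy' : 1 + y ≠ 0)
    (hτ : (1 + y) * τ = u * y - u ^ 2 * y * (1 + y)) :
    (u + τ / u) * (1 - (u + τ / u)) + 4 * τ = y / (1 + y) ^ 2 + τ * (1 + y) ^ 2 / y := by
  obtain rfl : τ = u * y / (1 + y) - u ^ 2 * y := by field_simp; linear_combination hτ
  field_simp
  ring

theorem discr_eq {u y τ : K} (hu : u ≠ 0) (hy' : 1 + y ≠ 0)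
    (hτ : (1 + y) * τ = u * y - u ^ 2 * y * (1 + y)) :
    (1 + y) ^ 2 * ((1 - (u + τ / u)) ^ 2 - 4 * τ) = (1 - u * (1 + y) ^ 2) ^ 2 := by
  obtain rfl : τ = u * y / (1 + y) - u ^ 2 * y := by field_simp; linear_combination hτ
  field_simp
  ring

variable [CharZero K]

theorem param_eq {l Q n N R γ u : K} (hn : n = 1 - l + l ^ 2) (hn0 : n ≠ 0)
    (h1 : 1 - l ≠ 0) (h2 : 1 + l ≠ 0) (hQ : Q ≠ 0) (q1 : 1 + n * Q ≠ 0) (q2 : 1 + n * l * Q ≠ 0)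
    (q3 : 1 + l ^ 3 * Q ≠ 0) (q4 : 1 + l ^ 2 * Q ≠ 0)
    (hN : N = n / ((1 - l) * (1 + l))) (hR : R = l * (1 - l) ^ 2 / ((1 + l) ^ 2 * n))
    (hγ : γ = (1 - l) ^ 2 * Q / ((1 + n * Q) * (1 + l ^ 3 * Q)))
    (hu : u = n ^ 3 / ((1 - l) * (1 + l) ^ 3) * Q * (1 + l ^ 3 * Q) * (1 + l ^ 2 * Q) / ((1 + n * Q) * (1 + n * l * Q))) :
    u + R * N ^ 4 / u = 1 / 2 - N * ((1 - R) / 2 - R / (γ * (1 - γ))) * (1 - 2 * γ) := by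
  have hγ' : 1 - γ = (1 + l ^ 2 * Q) * (1 + n * l * Q) / ((1 + n * Q) * (1 + l ^ 3 * Q)) := by
    rw [hγ, eq_div_iff (by positivity), sub_mul, div_mul_cancel₀ _ (by positivity)]
    subst hn
    ring
  have hγ2 : 1 - 2 * γ = (1 - γ) - γ := by ring
  rw [hγ2, hγ', hγ, hu, hN, hR]
  field_simp
  rw [hn]
  ring

theorem reduced_discr_eq {a κ N R τ s P : K} (hκ : κ ≠ 0) (hκR : κ - R ≠ 0) (hκ1 : κ - 1 ≠ 0)
    (hN : N ≠ 0) (hrel : 1 + 16 * R * N ^ 4 = N ^ 2 * (1 + 18 * R - 27 * R ^ 2))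
    (hτ : τ = R * N ^ 4) (ha : N ^ 2 * (κ ^ 3 - κ ^ 2) + a * (κ - R) = 0)
    (hs : s * (1 - s) + 4 * τ = a + τ / a) (hP : P = κ + R / κ) :
    (1 / 2 - s) ^ 2 * (P - 1 - R) =
      N ^ 2 * (P - (1 + 3 * R) / 2) ^ 2 * (P - 1 + 3 * R) := by
  have h1 : (1 / 2 - s) ^ 2 = N ^ 2 * (1 + 18 * R - 27 * R ^ 2) / 4 - a - τ / a := by
    linear_combination (-1) * hs - 4 * hτ * (-1) + hrel / 4
  have ha' : a = - (N ^ 2 * κ ^ 2 * (κ - 1)) / (κ - R) := by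
    rw [eq_div_iff hκR]
    linear_combination ha
  rw [h1, hτ, ha', hP]
  field_simp
  ring

theorem eq_of_reduced_discr {N R s P γ : K} (hN : N ≠ 0) (hR : R ≠ 0)
    (hx : P - (1 + 3 * R) / 2 ≠ 0)
    (h : (1 / 2 - s) ^ 2 * (P - 1 - R) = N ^ 2 * (P - (1 + 3 * R) / 2) ^ 2 * (P - 1 + 3 * R))
    (hγ : (1 - 2 * γ) * (N * (P - (1 + 3 * R) / 2)) = 1 / 2 - s) :
    γ * (1 - γ) * (P - 1 - R) = -R ∧
      s = 1 / 2 - N * ((1 - R) / 2 - R / (γ * (1 - γ))) * (1 - 2 * γ) := by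
  have h1 : γ * (1 - γ) * (P - 1 - R) = -R := by
    have : (N * (P - (1 + 3 * R) / 2)) ^ 2 ≠ 0 := by positivity
    apply mul_left_cancel₀ this
    linear_combination (-1 / 4) * h + (P - 1 - R) / 4 * ((1 - 2 * γ) * (N * (P - (1 + 3 * R) / 2)) + (1 / 2 - s)) * (-1) * hγ
  refine ⟨h1, ?_⟩
  have h2 : γ * (1 - γ) ≠ 0 := by
    intro h0
    rw [h0, zero_mul, eq_comm, neg_eq_zero] at h1
    exact hR h1
  have h3 : R / (γ * (1 - γ)) = -(P - 1 - R) := by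
    rw [div_eq_iff h2]
    linear_combination h1
  rw [h3]
  linear_combination hγ

theorem eq_of_param {N R γ δ : K} (hN : N ≠ 0) (hγ : γ * (1 - γ) ≠ 0) (hδ : δ * (1 - δ) ≠ 0)
    (h : 1 / 2 - N * ((1 - R) / 2 - R / (γ * (1 - γ))) * (1 - 2 * γ) =
      1 / 2 - N * ((1 - R) / 2 - R / (δ * (1 - δ))) * (1 - 2 * δ))
    (hE : (1 - R) * (γ * δ * (1 - γ) * (1 - δ)) - R * ((1 - γ) * (1 - δ)) - R * (γ * δ) ≠ 0) :
    γ = δ := by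
  obtain ⟨g0, g1⟩ := mul_ne_zero_iff.1 hγ
  obtain ⟨d0, d1⟩ := mul_ne_zero_iff.1 hδ
  field_simp at h
  refine sub_eq_zero.1 ((mul_eq_zero.1 (?_ : (γ - δ) * _ = 0)).resolve_right hE)
  apply mul_left_cancel₀ hN
  linear_combination h / 2

theorem solution_sq_eq {l Q n N R γ W s : K} (hn : n = 1 - l + l ^ 2) (hn0 : n ≠ 0)
    (h1 : 1 - l ≠ 0) (h2 : 1 + l ≠ 0) (hQ : Q ≠ 0)
    (q1 : 1 + n * Q ≠ 0) (q3 : 1 + l ^ 3 * Q ≠ 0) (hγ1 : 1 - γ ≠ 0)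
    (hN : N = n / ((1 - l) * (1 + l))) (hR : R = l * (1 - l) ^ 2 / ((1 + l) ^ 2 * n))
    (hγ : γ = (1 - l) ^ 2 * Q / ((1 + n * Q) * (1 + l ^ 3 * Q)))
    (hs : s = 1 / 2 - N * ((1 - R) / 2 - R / (γ * (1 - γ))) * (1 - 2 * γ))
    (hW : W * (((1 + n * Q) * (1 + l ^ 3 * Q)) ^ 2
        - 2 * (1 - l) * Q * ((1 + n * Q) * (1 + l ^ 3 * Q)) + (1 + l ^ 2) * (1 - l) ^ 3 * Q ^ 2) =
      (1 - l ^ 3 * n * Q ^ 2) * ((1 + n * Q) * (1 + l ^ 3 * Q)))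
    (hd : ((1 + n * Q) * (1 + l ^ 3 * Q)) ^ 2
        - 2 * (1 - l) * Q * ((1 + n * Q) * (1 + l ^ 3 * Q)) + (1 + l ^ 2) * (1 - l) ^ 3 * Q ^ 2 ≠ 0) :
    W ^ 2 * ((1 - s) ^ 2 - 4 * (R * N ^ 4)) =
      N ^ 2 * ((1 + R - R / (γ * (1 - γ))) ^ 2 - 4 * R) := by
  set D := (1 + n * Q) * (1 + l ^ 3 * Q) with hD
  have hD0 : D ≠ 0 := mul_ne_zero q1 q3
  set δ := Q / D with hδ
  have hQδ : Q = δ * D := by rw [hδ, div_mul_cancel₀ _ hD0]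
  have hγδ : γ = (1 - l) ^ 2 * δ := by rw [hγ, hδ, mul_div_assoc]
  have hδ0 : δ ≠ 0 := div_ne_zero hQ hD0
  set e := 1 - 2 * (1 - l) * δ + (1 + l ^ 2) * (1 - l) ^ 3 * δ ^ 2 with he
  have hed : D ^ 2 - 2 * (1 - l) * Q * D + (1 + l ^ 2) * (1 - l) ^ 3 * Q ^ 2 = D ^ 2 * e := by
    rw [he, hQδ]; ring
  have he0 : e ≠ 0 := by
    rw [hed] at hd
    exact (mul_ne_zero_iff.1 hd).2
  have hW2 : (W * e) ^ 2 = (1 - (n + l ^ 3) * δ) ^ 2 - 4 * l ^ 3 * n * δ ^ 2 := by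
    have h3 : W * e * D = 1 - l ^ 3 * n * Q ^ 2 := by
      apply mul_right_cancel₀ hD0
      rw [← hW, hed]
      ring
    have h4 : 1 + l ^ 3 * n * Q ^ 2 = D * (1 - (n + l ^ 3) * δ) := by
      have : D * δ = Q := by rw [mul_comm]; exact hQδ.symm
      linear_combination (-1) * hD + (n + l ^ 3) * this
    apply mul_right_cancel₀ (pow_ne_zero 2 hD0)
    calc (W * e) ^ 2 * D ^ 2 = (1 + l ^ 3 * n * Q ^ 2) ^ 2 - 4 * l ^ 3 * n * Q ^ 2 := by
          rw [← mul_pow, h3]; ring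
      _ = _ := by rw [h4, hQδ]; ring
  apply mul_left_cancel₀ (pow_ne_zero 2 he0)
  rw [← mul_assoc, ← mul_pow, mul_comm e, hW2, hs, he]
  clear_value e δ
  rw [hγδ] at hγ1 ⊢
  rw [hR, hN]
  clear hW2 hed hW hd hD hQδ hγδ he hR hN hs hγ hδ
  clear_value D
  subst hn
  field_simp
  ring

end FieldIdentities

section KernelIdentity

variable {K : Type*} [Field K] [CharZero K]

theorem kernel_identity_sq {u y τ l n N R Q κ W B s g δ P : K}
    (hn : n = 1 - l + l ^ 2) (hτ : (1 + y) * τ = u * y - u ^ 2 * y * (1 + y))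
    (hl : τ * ((1 - l) ^ 2 * (1 + l) ^ 6) = l * n ^ 3)
    (hN : N * ((1 - l) * (1 + l)) = n) (hR : R * ((1 + l) ^ 2 * n) = l * (1 - l) ^ 2)
    (hQ : n ^ 3 * Q * (1 + l ^ 3 * Q) * (1 + l ^ 2 * Q) =
      u * ((1 - l) * (1 + l) ^ 3) * ((1 + n * Q) * (1 + n * l * Q)))
    (hκ : N ^ 2 * (κ ^ 3 - κ ^ 2) * (1 + y) ^ 2 + y * (κ - R) = 0)
    (hW : W * (((1 + n * Q) * (1 + l ^ 3 * Q)) ^ 2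
        - 2 * (1 - l) * Q * ((1 + n * Q) * (1 + l ^ 3 * Q)) + (1 + l ^ 2) * (1 - l) ^ 3 * Q ^ 2) =
      (1 - l ^ 3 * n * Q ^ 2) * ((1 + n * Q) * (1 + l ^ 3 * Q)))
    (hB : B * κ = N * (κ ^ 2 - R)) (hs : u * s = u ^ 2 + τ) (hP : P * κ = κ ^ 2 + R)
    (hg : g * ((1 + n * Q) * (1 + l ^ 3 * Q)) = (1 - l) ^ 2 * Q)
    (hδ : (1 - 2 * δ) * (N * (2 * P - 1 - 3 * R)) = 1 - 2 * s)
    (hu0 : u ≠ 0) (hy0 : y ≠ 0) (hy1 : 1 + y ≠ 0) (hn0 : n ≠ 0) (hl0 : l ≠ 0) (h1 : 1 - l ≠ 0)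
    (h2 : 1 + l ≠ 0) (hQ0 : Q ≠ 0) (q1 : 1 + n * Q ≠ 0) (q2 : 1 + n * l * Q ≠ 0)
    (q3 : 1 + l ^ 3 * Q ≠ 0) (q4 : 1 + l ^ 2 * Q ≠ 0)
    (hd : ((1 + n * Q) * (1 + l ^ 3 * Q)) ^ 2
        - 2 * (1 - l) * Q * ((1 + n * Q) * (1 + l ^ 3 * Q)) + (1 + l ^ 2) * (1 - l) ^ 3 * Q ^ 2 ≠ 0)
    (hκ0 : κ ≠ 0) (hκR : κ - R ≠ 0) (hx : 2 * P - 1 - 3 * R ≠ 0) (hg1 : 1 - g ≠ 0)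
    (hE : (1 - R) * (g * δ * (1 - g) * (1 - δ)) - R * ((1 - g) * (1 - δ)) - R * (g * δ) ≠ 0) :
    ((1 - u * (1 + y) ^ 2) * W) ^ 2 = ((1 + y) * B) ^ 2 := by
  have hN' : N = n / ((1 - l) * (1 + l)) := by rw [eq_div_iff (by positivity), hN]
  have hR' : R = l * (1 - l) ^ 2 / ((1 + l) ^ 2 * n) := by rw [eq_div_iff (by positivity), hR]
  have hg' : g = (1 - l) ^ 2 * Q / ((1 + n * Q) * (1 + l ^ 3 * Q)) := by
    rw [eq_div_iff (by positivity), hg]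
  have hN0 : N ≠ 0 := by rw [hN']; positivity
  have hR0 : R ≠ 0 := by rw [hR']; positivity
  have hτ' : τ = R * N ^ 4 := by
    rw [← eq_div_iff (by positivity)] at hl
    rw [hl, hR', hN']
    field_simp
  have hrel : 1 + 16 * R * N ^ 4 = N ^ 2 * (1 + 18 * R - 27 * R ^ 2) := by
    rw [hR', hN']
    field_simp
    rw [hn]
    ring
  have hκ1 : κ - 1 ≠ 0 := by
    intro h
    rw [sub_eq_zero.1 h] at hκ hκR
    exact mul_ne_zero hy0 hκR (by linear_combination hκ)
  have hs' : s = u + τ / u := by field_simp; linear_combination hs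
  have ha : N ^ 2 * (κ ^ 3 - κ ^ 2) + y / (1 + y) ^ 2 * (κ - R) = 0 := by
    field_simp
    linear_combination hκ
  have hP' : P = κ + R / κ := by field_simp; linear_combination hP
  have hss : s * (1 - s) + 4 * τ = y / (1 + y) ^ 2 + τ / (y / (1 + y) ^ 2) := by
    rw [hs', sum_mul_one_sub_sum hu0 hy0 hy1 hτ, div_div_eq_mul_div]
  obtain ⟨hδP, hsδ⟩ := eq_of_reduced_discr (γ := δ) hN0 hR0 (fun h => hx (by linear_combination 2 * h))
    (reduced_discr_eq hκ0 hκR hκ1 hN0 hrel hτ' ha hss hP') (by linear_combination hδ / 2)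
  have hδ0 : δ * (1 - δ) ≠ 0 := by
    intro h0
    rw [h0, zero_mul, eq_comm, neg_eq_zero] at hδP
    exact hR0 hδP
  have hg0 : g ≠ 0 := by rw [hg']; positivity
  have hsg : s = 1 / 2 - N * ((1 - R) / 2 - R / (g * (1 - g))) * (1 - 2 * g) := by
    rw [hs', hτ']
    refine param_eq hn hn0 h1 h2 hQ0 q1 q2 q3 q4 hN' hR' hg' ?_
    field_simp
    linear_combination (-1) * hQ
  obtain rfl : g = δ := eq_of_param hN0 (mul_ne_zero hg0 hg1) hδ0 (hsg.symm.trans hsδ) hE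
  have hPg : 1 + R - R / (g * (1 - g)) = P := by
    field_simp
    linear_combination (-1) * hδP
  have hsq := solution_sq_eq hn hn0 h1 h2 hQ0 q1 q3 hg1 hN' hR' hg' hsg hW hd
  rw [hPg, ← hτ'] at hsq
  have hdis := discr_eq hu0 hy1 hτ
  rw [← hs'] at hdis
  have hBP : B ^ 2 = N ^ 2 * (P ^ 2 - 4 * R) := by
    apply mul_right_cancel₀ (pow_ne_zero 2 hκ0)
    linear_combination (B * κ + N * (κ ^ 2 - R)) * hB - N ^ 2 * (P * κ + κ ^ 2 + R) * hP
  linear_combination (-1) * W ^ 2 * hdis + (1 + y) ^ 2 * hsq - (1 + y) ^ 2 * hBP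

/-- `kernel_identity_sq` over an integral domain. -/
theorem kernel_identity_sq_of_isDomain {A : Type*} [CommRing A] [IsDomain A] [CharZero A]
    {u y τ l n N R Q κ W B s g δ P : A}
    (hn : n = 1 - l + l ^ 2) (hτ : (1 + y) * τ = u * y - u ^ 2 * y * (1 + y))
    (hl : τ * ((1 - l) ^ 2 * (1 + l) ^ 6) = l * n ^ 3)
    (hN : N * ((1 - l) * (1 + l)) = n) (hR : R * ((1 + l) ^ 2 * n) = l * (1 - l) ^ 2)
    (hQ : n ^ 3 * Q * (1 + l ^ 3 * Q) * (1 + l ^ 2 * Q) =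
      u * ((1 - l) * (1 + l) ^ 3) * ((1 + n * Q) * (1 + n * l * Q)))
    (hκ : N ^ 2 * (κ ^ 3 - κ ^ 2) * (1 + y) ^ 2 + y * (κ - R) = 0)
    (hW : W * (((1 + n * Q) * (1 + l ^ 3 * Q)) ^ 2
        - 2 * (1 - l) * Q * ((1 + n * Q) * (1 + l ^ 3 * Q)) + (1 + l ^ 2) * (1 - l) ^ 3 * Q ^ 2) =
      (1 - l ^ 3 * n * Q ^ 2) * ((1 + n * Q) * (1 + l ^ 3 * Q)))
    (hB : B * κ = N * (κ ^ 2 - R)) (hs : u * s = u ^ 2 + τ) (hP : P * κ = κ ^ 2 + R)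
    (hg : g * ((1 + n * Q) * (1 + l ^ 3 * Q)) = (1 - l) ^ 2 * Q)
    (hδ : (1 - 2 * δ) * (N * (2 * P - 1 - 3 * R)) = 1 - 2 * s)
    (hu0 : u ≠ 0) (hy0 : y ≠ 0) (hy1 : 1 + y ≠ 0) (hn0 : n ≠ 0) (hl0 : l ≠ 0) (h1 : 1 - l ≠ 0)
    (h2 : 1 + l ≠ 0) (hQ0 : Q ≠ 0) (q1 : 1 + n * Q ≠ 0) (q2 : 1 + n * l * Q ≠ 0)
    (q3 : 1 + l ^ 3 * Q ≠ 0) (q4 : 1 + l ^ 2 * Q ≠ 0)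
    (hd : ((1 + n * Q) * (1 + l ^ 3 * Q)) ^ 2
        - 2 * (1 - l) * Q * ((1 + n * Q) * (1 + l ^ 3 * Q)) + (1 + l ^ 2) * (1 - l) ^ 3 * Q ^ 2 ≠ 0)
    (hκ0 : κ ≠ 0) (hκR : κ - R ≠ 0) (hx : 2 * P - 1 - 3 * R ≠ 0) (hg1 : 1 - g ≠ 0)
    (hE : (1 - R) * (g * δ * (1 - g) * (1 - δ)) - R * ((1 - g) * (1 - δ)) - R * (g * δ) ≠ 0) :
    ((1 - u * (1 + y) ^ 2) * W) ^ 2 = ((1 + y) * B) ^ 2 := by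
  have hφ : Function.Injective (algebraMap A (FractionRing A)) := IsFractionRing.injective _ _
  have : CharZero (FractionRing A) := charZero_of_injective_algebraMap hφ
  generalize algebraMap A (FractionRing A) = φ at hφ
  have h0 : ∀ {x : A}, x ≠ 0 → φ x ≠ 0 := fun h => (map_ne_zero_iff φ hφ).2 h
  apply hφ
  simp only [map_add, map_mul, map_sub, map_pow, map_one]
  apply kernel_identity_sq (K := FractionRing A) (τ := φ τ) (l := φ l) (n := φ n) (N := φ N) (R := φ R)
    (Q := φ Q) (κ := φ κ) (s := φ s) (g := φ g) (δ := φ δ) (P := φ P)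
  · simpa only [map_add, map_mul, map_sub, map_pow, map_one, map_zero, map_ofNat] using congrArg φ hn
  · simpa only [map_add, map_mul, map_sub, map_pow, map_one, map_zero, map_ofNat] using congrArg φ hτ
  · simpa only [map_add, map_mul, map_sub, map_pow, map_one, map_zero, map_ofNat] using congrArg φ hl
  · simpa only [map_add, map_mul, map_sub, map_pow, map_one, map_zero, map_ofNat] using congrArg φ hN
  · simpa only [map_add, map_mul, map_sub, map_pow, map_one, map_zero, map_ofNat] using congrArg φ hR
  · simpa only [map_add, map_mul, map_sub, map_pow, map_one, map_zero, map_ofNat] using congrArg φ hQ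
  · simpa only [map_add, map_mul, map_sub, map_pow, map_one, map_zero, map_ofNat] using congrArg φ hκ
  · simpa only [map_add, map_mul, map_sub, map_pow, map_one, map_zero, map_ofNat] using congrArg φ hW
  · simpa only [map_add, map_mul, map_sub, map_pow, map_one, map_zero, map_ofNat] using congrArg φ hB
  · simpa only [map_add, map_mul, map_sub, map_pow, map_one, map_zero, map_ofNat] using congrArg φ hs
  · simpa only [map_add, map_mul, map_sub, map_pow, map_one, map_zero, map_ofNat] using congrArg φ hP
  · simpa only [map_add, map_mul, map_sub, map_pow, map_one, map_zero, map_ofNat] using congrArg φ hg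
  · simpa only [map_add, map_mul, map_sub, map_pow, map_one, map_zero, map_ofNat] using congrArg φ hδ
  · simpa only [map_add, map_mul, map_sub, map_pow, map_one, map_zero, map_ofNat] using h0 hu0
  · simpa only [map_add, map_mul, map_sub, map_pow, map_one, map_zero, map_ofNat] using h0 hy0
  · simpa only [map_add, map_mul, map_sub, map_pow, map_one, map_zero, map_ofNat] using h0 hy1
  · simpa only [map_add, map_mul, map_sub, map_pow, map_one, map_zero, map_ofNat] using h0 hn0
  · simpa only [map_add, map_mul, map_sub, map_pow, map_one, map_zero, map_ofNat] using h0 hl0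
  · simpa only [map_add, map_mul, map_sub, map_pow, map_one, map_zero, map_ofNat] using h0 h1
  · simpa only [map_add, map_mul, map_sub, map_pow, map_one, map_zero, map_ofNat] using h0 h2
  · simpa only [map_add, map_mul, map_sub, map_pow, map_one, map_zero, map_ofNat] using h0 hQ0
  · simpa only [map_add, map_mul, map_sub, map_pow, map_one, map_zero, map_ofNat] using h0 q1
  · simpa only [map_add, map_mul, map_sub, map_pow, map_one, map_zero, map_ofNat] using h0 q2
  · simpa only [map_add, map_mul, map_sub, map_pow, map_one, map_zero, map_ofNat] using h0 q3
  · simpa only [map_add, map_mul, map_sub, map_pow, map_one, map_zero, map_ofNat] using h0 q4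
  · simpa only [map_add, map_mul, map_sub, map_pow, map_one, map_zero, map_ofNat] using h0 hd
  · simpa only [map_add, map_mul, map_sub, map_pow, map_one, map_zero, map_ofNat] using h0 hκ0
  · simpa only [map_add, map_mul, map_sub, map_pow, map_one, map_zero, map_ofNat] using h0 hκR
  · simpa only [map_add, map_mul, map_sub, map_pow, map_one, map_zero, map_ofNat] using h0 hx
  · simpa only [map_add, map_mul, map_sub, map_pow, map_one, map_zero, map_ofNat] using h0 hg1
  · simpa only [map_add, map_mul, map_sub, map_pow, map_one, map_zero, map_ofNat] using h0 hE

end KernelIdentity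

section Parametrization

open MvPowerSeries

theorem exists_fixed_of_polynomial {σ : Type*} (s : σ) (c : MvPowerSeries σ ℚ)
    (p : Polynomial (MvPowerSeries σ ℚ)) : ∃ x, c + X s * p.eval x = x := by
  refine exists_fixed_of_contraction s (fun x => c + X s * p.eval x) fun x y => ?_
  rw [add_sub_add_left_eq_sub, ← mul_sub]
  exact mul_dvd_mul_left _ (Polynomial.sub_dvd_eval_sub x y p)

theorem exists_ell : ∃ l : MvPowerSeries Unit ℚ,
    X () * ((1 - l) ^ 2 * (1 + l) ^ 6) = l * (1 - l + l ^ 2) ^ 3 ∧ constantCoeff l = 0 := by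
  obtain ⟨x, hx⟩ := exists_fixed_of_polynomial () (1 : MvPowerSeries Unit ℚ)
    (Polynomial.X * ((4 + 6 * (Polynomial.C (X ()) * Polynomial.X)
        + 4 * (Polynomial.C (X ()) * Polynomial.X) ^ 2 + (Polynomial.C (X ()) * Polynomial.X) ^ 3)
      + (-2 * (Polynomial.C (X ()) * Polynomial.X) + (Polynomial.C (X ()) * Polynomial.X) ^ 3)
        * (1 + (Polynomial.C (X ()) * Polynomial.X)) ^ 4
      - Polynomial.X * ((Polynomial.C (X ()) * Polynomial.X) - 1)
        * (1 + (1 - Polynomial.C (X ()) * Polynomial.X + (Polynomial.C (X ()) * Polynomial.X) ^ 2)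
          + (1 - Polynomial.C (X ()) * Polynomial.X
            + (Polynomial.C (X ()) * Polynomial.X) ^ 2) ^ 2)))
  simp only [Polynomial.eval_add, Polynomial.eval_sub, Polynomial.eval_mul, Polynomial.eval_pow,
    Polynomial.eval_X, Polynomial.eval_C, Polynomial.eval_one, Polynomial.eval_ofNat,
    Polynomial.eval_neg] at hx
  refine ⟨X () * x, ?_, by simp⟩
  linear_combination X () * hx

/-- The algebraic series `ℓ` uniformizing the counting series. -/
noncomputable def ell : MvPowerSeries Unit ℚ := exists_ell.choose

theorem ell_spec : X () * ((1 - ell) ^ 2 * (1 + ell) ^ 6) = ell * (1 - ell + ell ^ 2) ^ 3 :=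
  exists_ell.choose_spec.1

theorem constantCoeff_ell : constantCoeff ell = 0 := exists_ell.choose_spec.2

/-- The norm factor of the uniformization. -/
noncomputable def ellN : MvPowerSeries Unit ℚ :=
  (1 - ell + ell ^ 2) * ((1 - ell) * (1 + ell))⁻¹

/-- The product of the roots in the uniformization. -/
noncomputable def ellR : MvPowerSeries Unit ℚ :=
  ell * (1 - ell) ^ 2 * ((1 + ell) ^ 2 * (1 - ell + ell ^ 2))⁻¹

theorem ellN_spec : ellN * ((1 - ell) * (1 + ell)) = 1 - ell + ell ^ 2 := by
  have := MvPowerSeries.mul_inv_cancel ((1 - ell) * (1 + ell)) (by simp [constantCoeff_ell])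
  rw [ellN]
  linear_combination (1 - ell + ell ^ 2) * this

theorem ellR_spec : ellR * ((1 + ell) ^ 2 * (1 - ell + ell ^ 2)) = ell * (1 - ell) ^ 2 := by
  have := MvPowerSeries.mul_inv_cancel ((1 + ell) ^ 2 * (1 - ell + ell ^ 2))
    (by simp [constantCoeff_ell])
  rw [ellR]
  linear_combination (ell * (1 - ell) ^ 2) * this

theorem constantCoeff_ellN : constantCoeff ellN = 1 := by
  simpa [constantCoeff_ell] using congrArg constantCoeff ellN_spec

theorem constantCoeff_ellR : constantCoeff ellR = 0 := by
  simpa [constantCoeff_ell] using congrArg constantCoeff ellR_spec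

theorem exists_uParam {l n : MvPowerSeries (Fin 2) ℚ} (hn : constantCoeff n = 1) :
    ∃ Q, n ^ 3 * Q * (1 + l ^ 3 * Q) * (1 + l ^ 2 * Q) =
      X 0 * ((1 - l) * (1 + l) ^ 3) * ((1 + n * Q) * (1 + n * l * Q)) ∧ X 0 ∣ Q := by
  have hn' := MvPowerSeries.mul_inv_cancel (n ^ 3) (by simp [hn])
  obtain ⟨x, hx⟩ := exists_fixed_of_polynomial 0 ((1 - l) * (1 + l) ^ 3 * (n ^ 3)⁻¹)
    (Polynomial.C ((1 - l) * (1 + l) ^ 3 * (n ^ 3)⁻¹) * (Polynomial.C (n + n * l) * Polynomial.X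
      + Polynomial.C (n ^ 2 * l * X 0) * Polynomial.X ^ 2) -
      Polynomial.X ^ 2 * (Polynomial.C (l ^ 3 + l ^ 2) + Polynomial.C (l ^ 5 * X 0) * Polynomial.X))
  simp only [Polynomial.eval_add, Polynomial.eval_sub, Polynomial.eval_mul, Polynomial.eval_pow,
    Polynomial.eval_X, Polynomial.eval_C] at hx
  refine ⟨X 0 * x, ?_, dvd_mul_right _ _⟩
  linear_combination (-1) * X 0 * n ^ 3 * hx + X 0 * ((1 - l) * (1 + l) ^ 3) *
    ((1 + n * (X 0 * x)) * (1 + n * l * (X 0 * x))) * hn'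

theorem exists_yParam {N R : MvPowerSeries (Fin 2) ℚ} (hN : constantCoeff N = 1) :
    ∃ κ, N ^ 2 * (κ ^ 3 - κ ^ 2) * (1 + X 0) ^ 2 + X 0 * (κ - R) = 0 ∧ X 0 ∣ κ - 1 := by
  have hα := MvPowerSeries.mul_inv_cancel (N ^ 2 * (1 + X 0) ^ 2) (by simp [hN])
  set α := (N ^ 2 * (1 + X 0) ^ 2)⁻¹
  obtain ⟨w, hw⟩ := exists_fixed_of_polynomial 0 (-α * (1 - R))
    (- (Polynomial.C 2 * Polynomial.X ^ 2 + Polynomial.C (X 0) * Polynomial.X ^ 3 +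
      Polynomial.C α * Polynomial.X))
  simp only [Polynomial.eval_add, Polynomial.eval_mul, Polynomial.eval_pow, Polynomial.eval_X,
    Polynomial.eval_C, Polynomial.eval_neg] at hw
  refine ⟨1 + X 0 * w, ?_, ⟨w, by ring⟩⟩
  linear_combination (-1) * X 0 * (N ^ 2 * (1 + X 0) ^ 2) * hw -
    X 0 * (1 - R + X 0 * w) * hα

/-- The inclusion of series in one variable as series in the second of two variables. -/
noncomputable def inT : MvPowerSeries Unit ℚ →ₐ[ℚ] MvPowerSeries (Fin 2) ℚ :=
  substHom (fun _ => X 1) (by simp)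

/-- Substitution of the kernel root in a series in one variable. -/
noncomputable def inKernel : MvPowerSeries Unit ℚ →ₐ[ℚ] MvPowerSeries (Fin 2) ℚ :=
  substHom (fun _ => kernelRoot) fun _ => constantCoeff_kernelRoot

theorem constantCoeff_inT (f : MvPowerSeries Unit ℚ) :
    constantCoeff (inT f) = constantCoeff f := constantCoeff_substHom _ _ f

theorem constantCoeff_inKernel (f : MvPowerSeries Unit ℚ) :
    constantCoeff (inKernel f) = constantCoeff f := constantCoeff_substHom _ _ f

theorem substU_inT (f : MvPowerSeries Unit ℚ) : substU (inT f) = inKernel f :=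
  substHom_substHom _ _ _ _ _ _ (fun _ => substU_X_one) f

theorem substY_inT (f : MvPowerSeries Unit ℚ) : substY (inT f) = inKernel f :=
  substHom_substHom _ _ _ _ _ _ (fun _ => substY_X_one) f

theorem exists_uParam_inT : ∃ Q, (1 - inT ell + inT ell ^ 2) ^ 3 * Q * (1 + inT ell ^ 3 * Q) *
    (1 + inT ell ^ 2 * Q) = X 0 * ((1 - inT ell) * (1 + inT ell) ^ 3) *
      ((1 + (1 - inT ell + inT ell ^ 2) * Q) * (1 + (1 - inT ell + inT ell ^ 2) * inT ell * Q)) ∧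
    X 0 ∣ Q :=
  exists_uParam (by simp [constantCoeff_inT, constantCoeff_ell])

theorem exists_yParam_inT : ∃ κ, inT ellN ^ 2 * (κ ^ 3 - κ ^ 2) * (1 + X 0) ^ 2 +
    X 0 * (κ - inT ellR) = 0 ∧ X 0 ∣ κ - 1 :=
  exists_yParam ((constantCoeff_inT _).trans constantCoeff_ellN)

/-- The uniformizing parameter for the first catalytic variable. -/
noncomputable def uParam : MvPowerSeries (Fin 2) ℚ := exists_uParam_inT.choose

theorem uParam_spec : (1 - inT ell + inT ell ^ 2) ^ 3 * uParam * (1 + inT ell ^ 3 * uParam) *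
    (1 + inT ell ^ 2 * uParam) = X 0 * ((1 - inT ell) * (1 + inT ell) ^ 3) *
      ((1 + (1 - inT ell + inT ell ^ 2) * uParam) *
        (1 + (1 - inT ell + inT ell ^ 2) * inT ell * uParam)) :=
  exists_uParam_inT.choose_spec.1

theorem X_dvd_uParam : X 0 ∣ uParam := exists_uParam_inT.choose_spec.2

theorem constantCoeff_uParam : constantCoeff uParam = 0 := by
  obtain ⟨x, hx⟩ := X_dvd_uParam
  simp [hx]

/-- The uniformizing parameter for the second catalytic variable. -/
noncomputable def yParam : MvPowerSeries (Fin 2) ℚ := exists_yParam_inT.choose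

theorem yParam_spec : inT ellN ^ 2 * (yParam ^ 3 - yParam ^ 2) * (1 + X 0) ^ 2 +
    X 0 * (yParam - inT ellR) = 0 :=
  exists_yParam_inT.choose_spec.1

theorem X_dvd_yParam_sub_one : X 0 ∣ yParam - 1 := exists_yParam_inT.choose_spec.2

theorem constantCoeff_yParam : constantCoeff yParam = 1 := by
  obtain ⟨x, hx⟩ := X_dvd_yParam_sub_one
  simpa [sub_eq_zero] using congrArg constantCoeff hx

end Parametrization

section Solution

open MvPowerSeries

/-- The factor `(1 + n Q) (1 + ℓ³ Q)`. -/
noncomputable def uFactor (l Q : MvPowerSeries (Fin 2) ℚ) : MvPowerSeries (Fin 2) ℚ :=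
  (1 + (1 - l + l ^ 2) * Q) * (1 + l ^ 3 * Q)

/-- The denominator of the first boundary series. -/
noncomputable def uDenom (l Q : MvPowerSeries (Fin 2) ℚ) : MvPowerSeries (Fin 2) ℚ :=
  uFactor l Q ^ 2 - 2 * (1 - l) * Q * uFactor l Q + (1 + l ^ 2) * (1 - l) ^ 3 * Q ^ 2

/-- The closed form of half the first boundary series. -/
noncomputable def uSol : MvPowerSeries (Fin 2) ℚ :=
  (1 - inT ell ^ 3 * (1 - inT ell + inT ell ^ 2) * uParam ^ 2) * uFactor (inT ell) uParam *
    (uDenom (inT ell) uParam)⁻¹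

theorem uSol_spec : uSol * uDenom (inT ell) uParam =
    (1 - inT ell ^ 3 * (1 - inT ell + inT ell ^ 2) * uParam ^ 2) * uFactor (inT ell) uParam := by
  have := MvPowerSeries.mul_inv_cancel (uDenom (inT ell) uParam)
    (by simp [uDenom, uFactor, constantCoeff_uParam])
  rw [uSol]
  linear_combination (1 - inT ell ^ 3 * (1 - inT ell + inT ell ^ 2) * uParam ^ 2) *
    uFactor (inT ell) uParam * this

theorem constantCoeff_uSol : constantCoeff uSol = 1 := by
  simpa [uDenom, uFactor, constantCoeff_uParam] using congrArg constantCoeff uSol_spec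

/-- The closed form of half the second boundary series, up to a factor. -/
noncomputable def ySol : MvPowerSeries (Fin 2) ℚ :=
  inT ellN * (yParam ^ 2 - inT ellR) * yParam⁻¹

theorem ySol_spec : ySol * yParam = inT ellN * (yParam ^ 2 - inT ellR) := by
  have := MvPowerSeries.mul_inv_cancel yParam (by simp [constantCoeff_yParam])
  rw [ySol]
  linear_combination inT ellN * (yParam ^ 2 - inT ellR) * this

theorem constantCoeff_ySol : constantCoeff ySol = 1 := by
  simpa [constantCoeff_yParam, constantCoeff_inT, constantCoeff_ellN, constantCoeff_ellR]
    using congrArg constantCoeff ySol_spec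

/-- The closed forms solve the kernel equation. -/
theorem solution_kernel_equation :
    (1 - X 0 * (1 + X 1) ^ 2) * substU uSol = substY ((1 + X 0) * ySol) := by
  have : IsDomain (MvPowerSeries (Fin 2) ℚ) := NoZeroDivisors.to_isDomain _
  have : CharZero (MvPowerSeries (Fin 2) ℚ) := algebraRat.charZero _
  have c2 : constantCoeff (2 : MvPowerSeries (Fin 2) ℚ) = 2 := map_ofNat _ 2
  have hl := congrArg inKernel ell_spec
  have hN := congrArg inKernel ellN_spec
  have hR := congrArg inKernel ellR_spec
  have hQ := congrArg substU uParam_spec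
  have hκ := congrArg substY yParam_spec
  have hW := congrArg substU uSol_spec
  have hB := congrArg substY ySol_spec
  have hT : inKernel (X ()) = kernelRoot := by simp [inKernel]
  simp only [map_mul, map_add, map_sub, map_pow, map_one, map_ofNat, map_zero, substU_inT,
    substY_inT, substU_X_zero, substY_X_zero, hT, uDenom, uFactor] at hl hN hR hQ hκ hW hB ⊢
  have cl : constantCoeff (inKernel ell) = 0 := (constantCoeff_inKernel _).trans constantCoeff_ell
  have cN : constantCoeff (inKernel ellN) = 1 := (constantCoeff_inKernel _).trans constantCoeff_ellN
  have cR : constantCoeff (inKernel ellR) = 0 := (constantCoeff_inKernel _).trans constantCoeff_ellR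
  have cQ : constantCoeff (substU uParam) = 0 :=
    (constantCoeff_substU _).trans constantCoeff_uParam
  have cκ : constantCoeff (substY yParam) = 1 :=
    (constantCoeff_substY _).trans constantCoeff_yParam
  have cW : constantCoeff (substU uSol) = 1 := (constantCoeff_substU _).trans constantCoeff_uSol
  have cB : constantCoeff (substY ySol) = 1 := (constantCoeff_substY _).trans constantCoeff_ySol
  generalize inKernel ell = l at *
  generalize inKernel ellN = N at *
  generalize inKernel ellR = R at *
  generalize substU uParam = Q at *
  generalize substY yParam = κ at *
  generalize substU uSol = W at *
  generalize substY ySol = B at *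
  obtain ⟨t, ht, ht'⟩ : ∃ t, X 0 * t = kernelRoot ∧ X 1 ∣ t :=
    ⟨X 1 * ((1 + X 1)⁻¹ - X 0), by rw [kernelRoot]; ring, dvd_mul_right _ _⟩
  have ct : constantCoeff t = 0 := by
    obtain ⟨x, rfl⟩ := ht'
    simp
  obtain ⟨P, hP⟩ : ∃ P, P * κ = κ ^ 2 + R := ⟨(κ ^ 2 + R) * κ⁻¹, by
    linear_combination (κ ^ 2 + R) * MvPowerSeries.mul_inv_cancel κ (by simp [cκ])⟩
  have cP : constantCoeff P = 1 := by simpa [cκ, cR] using congrArg constantCoeff hP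
  obtain ⟨g, hg⟩ : ∃ g, g * ((1 + (1 - l + l ^ 2) * Q) * (1 + l ^ 3 * Q)) = (1 - l) ^ 2 * Q :=
    ⟨(1 - l) ^ 2 * Q * ((1 + (1 - l + l ^ 2) * Q) * (1 + l ^ 3 * Q))⁻¹, by
      linear_combination (1 - l) ^ 2 * Q * MvPowerSeries.mul_inv_cancel
        ((1 + (1 - l + l ^ 2) * Q) * (1 + l ^ 3 * Q)) (by simp [cQ])⟩
  have cg : constantCoeff g = 0 := by simpa [cl, cQ] using congrArg constantCoeff hg
  obtain ⟨δ, hδ⟩ : ∃ δ, (1 - 2 * δ) * (N * (2 * P - 1 - 3 * R)) = 1 - 2 * (X 0 + t) := by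
    have h2 := MvPowerSeries.mul_inv_cancel (2 : MvPowerSeries (Fin 2) ℚ) (by simp [c2])
    refine ⟨2⁻¹ * (1 - (1 - 2 * (X 0 + t)) * (N * (2 * P - 1 - 3 * R))⁻¹), ?_⟩
    linear_combination (1 - 2 * (X 0 + t)) * MvPowerSeries.mul_inv_cancel
      (N * (2 * P - 1 - 3 * R)) (by simp [cN, cP, cR, c2]; norm_num) -
      N * (2 * P - 1 - 3 * R) * (1 - (1 - 2 * (X 0 + t)) * (N * (2 * P - 1 - 3 * R))⁻¹) * h2
  have hn0 : 1 - l + l ^ 2 ≠ 0 := ne_zero_of_constantCoeff (by simp [cl])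
  have h1 : 1 - l ≠ 0 := ne_zero_of_constantCoeff (by simp [cl])
  have h2 : 1 + l ≠ 0 := ne_zero_of_constantCoeff (by simp [cl])
  have q1 : 1 + (1 - l + l ^ 2) * Q ≠ 0 := ne_zero_of_constantCoeff (by simp [cQ])
  have q2 : 1 + (1 - l + l ^ 2) * l * Q ≠ 0 := ne_zero_of_constantCoeff (by simp [cQ])
  have hl0 : l ≠ 0 := by
    rintro rfl
    simp [kernelRoot_ne_zero] at hl
  have hQ0 : Q ≠ 0 := by
    rintro rfl
    simp [X_ne_zero', h1, h2] at hQ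
  have hE : (1 - R) * (g * δ * (1 - g) * (1 - δ)) - R * ((1 - g) * (1 - δ)) - R * (g * δ) ≠ 0 := by
    intro h
    replace h := congrArg (killVar 1) h
    replace hl := congrArg (killVar 1) hl
    replace hN := congrArg (killVar 1) hN
    replace hR := congrArg (killVar 1) hR
    replace hQ := congrArg (killVar 1) hQ
    replace hκ := congrArg (killVar 1) hκ
    replace hP := congrArg (killVar 1) hP
    replace hg := congrArg (killVar 1) hg
    replace hδ := congrArg (killVar 1) hδ
    have kt := (X_dvd_iff_killVar 1 t).1 ht'
    have kX : killVar 1 (X 0) = (X 0 : MvPowerSeries (Fin 2) ℚ) := killVar_X_of_ne (by decide)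
    rw [← constantCoeff_killVar 1] at cl cN cR cQ cκ cP cg
    simp only [map_mul, map_add, map_sub, map_pow, map_one, map_ofNat, map_zero, kt, kX,
      killVar_one_kernelRoot, killVar_X_self] at h hl hN hR hQ hκ hP hg hδ
    generalize killVar 1 l = l' at *
    generalize killVar 1 N = N' at *
    generalize killVar 1 R = R' at *
    generalize killVar 1 Q = Q' at *
    generalize killVar 1 κ = κ' at *
    generalize killVar 1 P = P' at *
    generalize killVar 1 g = g' at *
    generalize killVar 1 δ = δ' at *
    obtain rfl : l' = 0 := by
      rw [zero_mul, eq_comm] at hl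
      exact (mul_eq_zero.1 hl).resolve_right
        (pow_ne_zero _ (ne_zero_of_constantCoeff (by simp [cl])))
    obtain rfl : N' = 1 := by linear_combination hN
    obtain rfl : R' = 0 := by linear_combination hR
    obtain rfl : κ' = 1 := by
      have h0 : κ' ^ 2 * (κ' - 1) = 0 := by linear_combination hκ
      exact sub_eq_zero.1 ((mul_eq_zero.1 h0).resolve_left
        (pow_ne_zero _ (ne_zero_of_constantCoeff (by simp [cκ]))))
    obtain rfl : P' = 1 := by linear_combination hP
    obtain rfl : g' = X 0 := by
      have h0 : (1 + Q') * (g' - X 0) = 0 := by linear_combination hg + hQ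
      exact sub_eq_zero.1 ((mul_eq_zero.1 h0).resolve_left
        (ne_zero_of_constantCoeff (by simp [cQ])))
    obtain rfl : δ' = X 0 := by
      have h0 : 2 * (δ' - X 0) = 0 := by linear_combination (-1) * hδ
      exact sub_eq_zero.1 ((mul_eq_zero.1 h0).resolve_left
        (ne_zero_of_constantCoeff (by simp [c2])))
    have h0 : X 0 ^ 2 * (1 - X 0) ^ 2 = (0 : MvPowerSeries (Fin 2) ℚ) := by
      linear_combination h
    exact mul_ne_zero (pow_ne_zero _ (X_ne_zero' 0))
      (pow_ne_zero _ (ne_zero_of_constantCoeff (by simp))) h0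
  have key := kernel_identity_sq_of_isDomain (u := X 0) (y := X 1) (τ := kernelRoot)
    (s := X 0 + t) rfl (by linear_combination one_add_X_one_mul_kernelRoot) hl hN hR hQ hκ hW hB
    (by linear_combination ht) hP hg hδ (X_ne_zero' 0) (X_ne_zero' 1)
    (ne_zero_of_constantCoeff (by simp)) hn0 hl0 h1 h2 hQ0 q1 q2
    (ne_zero_of_constantCoeff (by simp [cl])) (ne_zero_of_constantCoeff (by simp [cl]))
    (ne_zero_of_constantCoeff (by simp [cl, cQ])) (ne_zero_of_constantCoeff (by simp [cκ]))
    (ne_zero_of_constantCoeff (by simp [cκ, cR]))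
    (ne_zero_of_constantCoeff (by simp [cP, cR, c2]; norm_num))
    (ne_zero_of_constantCoeff (by simp [cg])) hE
  refine (sq_eq_sq_iff_eq_or_eq_neg.1 key).resolve_right fun h => ?_
  have := congrArg constantCoeff h
  simp [cW, cB] at this
  norm_num at this

end Solution

section Extraction

open MvPowerSeries

theorem killVar_zero_uSol : killVar 0 uSol = 1 := by
  have h := congrArg (killVar 0) uSol_spec
  have hQ := (X_dvd_iff_killVar 0 uParam).1 X_dvd_uParam
  simpa [uDenom, uFactor, hQ] using h

theorem one_add_X_mul_killVar_one_ySol : (1 + X 0) * killVar 1 ySol = 1 := by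
  have c1 : constantCoeff (killVar 1 (inT ell)) = 0 := by
    rw [constantCoeff_killVar, constantCoeff_inT, constantCoeff_ell]
  have cκ : constantCoeff (killVar 1 yParam) = 1 := by
    rw [constantCoeff_killVar, constantCoeff_yParam]
  have hl := congrArg (fun f => killVar 1 (inT f)) ell_spec
  have hN := congrArg (fun f => killVar 1 (inT f)) ellN_spec
  have hR := congrArg (fun f => killVar 1 (inT f)) ellR_spec
  have hκ := congrArg (killVar 1) yParam_spec
  have hB := congrArg (killVar 1) ySol_spec
  have hT : inT (X ()) = X 1 := by simp [inT]
  have kX : killVar 1 (X 0) = (X 0 : MvPowerSeries (Fin 2) ℚ) := killVar_X_of_ne (by decide)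
  simp only [map_mul, map_add, map_sub, map_pow, map_one, map_zero, hT, kX, killVar_X_self]
    at hl hN hR hκ hB
  generalize killVar 1 (inT ell) = l at *
  generalize killVar 1 (inT ellN) = N at *
  generalize killVar 1 (inT ellR) = R at *
  generalize killVar 1 yParam = κ at *
  generalize killVar 1 ySol = B at *
  obtain rfl : l = 0 := by
    rw [zero_mul, eq_comm] at hl
    exact (mul_eq_zero.1 hl).resolve_right
      (pow_ne_zero _ (ne_zero_of_constantCoeff (by simp [c1])))
  obtain rfl : N = 1 := by linear_combination hN
  obtain rfl : R = 0 := by linear_combination hR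
  have hκ0 : κ ≠ 0 := ne_zero_of_constantCoeff (by simp [cκ])
  have h0 : κ * ((1 + X 0) * κ - X 0) * ((1 + X 0) * κ - 1) = 0 := by linear_combination hκ
  have h1 := (mul_eq_zero.1 h0).resolve_left
    (mul_ne_zero hκ0 (ne_zero_of_constantCoeff (by simp [cκ])))
  have h2 : B = κ := mul_right_cancel₀ hκ0 (by linear_combination hB)
  rw [h2]
  exact sub_eq_zero.1 h1

/-- The closed forms of the two boundary series. -/
theorem boundary_series_eq : 2 + X 0 * specU hcSeries = 2 * uSol ∧
    2 - X 1 * (1 + X 0) * (2 * (1 + X 0) * specY hcSeriesPos + specY (killVar 1 hcSeries)) =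
      2 * ((1 + X 0) * ySol) := by
  refine kernel_equation_unique kernel_equation ?_ ?_ ?_
  · rw [map_mul, map_mul substY, map_ofNat, map_ofNat]
    linear_combination 2 * solution_kernel_equation
  · rw [X_dvd_iff_killVar]
    simp only [map_sub, map_add, map_mul, killVar_X_self, killVar_zero_uSol, map_ofNat]
    ring
  · have kX : killVar 1 (X 0) = (X 0 : MvPowerSeries (Fin 2) ℚ) := killVar_X_of_ne (by decide)
    rw [X_dvd_iff_killVar]
    simp only [map_sub, map_add, map_mul, killVar_X_self, map_ofNat, map_one, kX]
    linear_combination (-2) * one_add_X_mul_killVar_one_ySol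

/-- Setting the first of two variables to zero. -/
noncomputable def evalT : MvPowerSeries (Fin 2) ℚ →ₐ[ℚ] MvPowerSeries Unit ℚ :=
  substHom ![0, X ()] (by simp [Fin.forall_fin_two])

/-- Setting the first two of three variables to zero. -/
noncomputable def evalT3 : MvPowerSeries (Fin 3) ℚ →ₐ[ℚ] MvPowerSeries Unit ℚ :=
  substHom ![0, 0, X ()] (by simp [Fin.forall_fin_succ])

theorem coeff_evalT3 (f : MvPowerSeries (Fin 3) ℚ) (m : ℕ) :
    coeff (Finsupp.single () m) (evalT3 f) = coeff (Finsupp.single 2 m) f := by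
  have ha : ∀ s, constantCoeff (![0, 0, X ()] s : MvPowerSeries Unit ℚ) = 0 := by
    simp [Fin.forall_fin_succ]
  rw [evalT3, substHom, substAlgHom_apply, coeff_subst (hasSubst_of_constantCoeff_zero ha),
    finsum_eq_single _ (Finsupp.single 2 m)]
  · simp [coeff_X_pow]
  · intro d hd
    rw [Finsupp.prod_fintype _ _ (fun _ => pow_zero _), Fin.prod_univ_three]
    by_cases h0 : d 0 = 0
    · by_cases h1 : d 1 = 0
      · have h2 : m ≠ d 2 := by
          rintro rfl
          apply hd
          ext i
          fin_cases i <;> simp [h0, h1]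
        simp [h0, h1, coeff_X_pow, h2]
      · simp [h1]
    · simp [h0]

theorem evalT_inT (f : MvPowerSeries Unit ℚ) : evalT (inT f) = f := by
  refine (substHom_substHom _ _ _ _ (fun _ => X ()) (by simp) ?_ f).trans ?_
  · simp
  · rw [substHom, substAlgHom_apply, ← map_algebraMap_eq_subst_X]
    simp

theorem evalT_specU (f : MvPowerSeries (Fin 3) ℚ) : evalT (specU f) = evalT3 f := by
  refine substHom_substHom _ _ _ _ _ _ ?_ f
  simp [Fin.forall_fin_succ]

theorem evalT_specY (f : MvPowerSeries (Fin 3) ℚ) : evalT (specY f) = evalT3 f := by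
  refine substHom_substHom _ _ _ _ _ _ ?_ f
  simp [Fin.forall_fin_succ]

theorem evalT3_killVar_one (f : MvPowerSeries (Fin 3) ℚ) :
    evalT3 (killVar 1 f) = evalT3 f := by
  refine substHom_substHom _ _ _ _ _ _ ?_ f
  simp [Fin.forall_fin_succ, Function.update_apply]

theorem evalT_eq_zero_of_dvd {f : MvPowerSeries (Fin 2) ℚ} (h : X 0 ∣ f) : evalT f = 0 := by
  obtain ⟨g, rfl⟩ := h
  simp [evalT]

theorem evalT3_hcSeries : (1 - ell + ell ^ 2) ^ 3 * evalT3 hcSeries =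
    2 * ((1 - ell) * (1 + ell) ^ 3 * (1 - ell - ell ^ 2 - ell ^ 3)) := by
  obtain ⟨q, hq⟩ := X_dvd_uParam
  have hQ := uParam_spec
  have hW := uSol_spec
  have hV := boundary_series_eq.1
  rw [hq] at hQ
  rw [uDenom, uFactor, hq] at hW
  set l := inT ell with hl
  have hQ' := mul_left_cancel₀ (X_ne_zero' (0 : Fin 2)) (b := (1 - l + l ^ 2) ^ 3 * q *
    (1 + l ^ 3 * (X 0 * q)) * (1 + l ^ 2 * (X 0 * q))) (c := (1 - l) * (1 + l) ^ 3 *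
    ((1 + (1 - l + l ^ 2) * (X 0 * q)) * (1 + (1 - l + l ^ 2) * l * (X 0 * q))))
    (by linear_combination hQ)
  have hW' : specU hcSeries * (((1 + (1 - l + l ^ 2) * (X 0 * q)) * (1 + l ^ 3 * (X 0 * q))) ^ 2
      - 2 * (1 - l) * (X 0 * q) * ((1 + (1 - l + l ^ 2) * (X 0 * q)) * (1 + l ^ 3 * (X 0 * q)))
      + (1 + l ^ 2) * (1 - l) ^ 3 * (X 0 * q) ^ 2) =
      2 * (q * ((2 * (1 - l) - (1 - l + l ^ 2 + l ^ 3 + (1 - l + l ^ 2) * l ^ 3 * (X 0 * q))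
        - l ^ 3 * (1 - l + l ^ 2) * (X 0 * q)) *
          ((1 + (1 - l + l ^ 2) * (X 0 * q)) * (1 + l ^ 3 * (X 0 * q)))
        - (1 + l ^ 2) * (1 - l) ^ 3 * (X 0 * q))) := by
    apply mul_left_cancel₀ (X_ne_zero' (0 : Fin 2))
    linear_combination 2 * hW +
      (((1 + (1 - l + l ^ 2) * (X 0 * q)) * (1 + l ^ 3 * (X 0 * q))) ^ 2
      - 2 * (1 - l) * (X 0 * q) * ((1 + (1 - l + l ^ 2) * (X 0 * q)) * (1 + l ^ 3 * (X 0 * q)))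
      + (1 + l ^ 2) * (1 - l) ^ 3 * (X 0 * q) ^ 2) * hV
  replace hQ' := congrArg evalT hQ'
  replace hW' := congrArg evalT hW'
  have h0 : evalT (X 0) = 0 := by simp [evalT]
  simp only [map_mul, map_add, map_sub, map_pow, map_one, map_ofNat, h0, hl, evalT_inT,
    evalT_specU] at hQ' hW'
  linear_combination (1 - ell + ell ^ 2) ^ 3 * hW' + 2 * (1 - ell - ell ^ 2 - ell ^ 3) * hQ'

/-- The closed form of the generating function of `halfCone 0 1`. -/
theorem evalT3_hcSeriesPos : X () * evalT3 hcSeriesPos * ((1 - ell) * (1 + ell) ^ 3) =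
    ell * (1 - ell - ell ^ 2 - ell ^ 3) := by
  have hA := congrArg evalT boundary_series_eq.2
  have hB := congrArg evalT ySol_spec
  have hκ := evalT_eq_zero_of_dvd X_dvd_yParam_sub_one
  have h0 : evalT (X 0) = 0 := by simp [evalT]
  have h1 : evalT (X 1) = X () := by simp [evalT]
  rw [map_sub, map_one, sub_eq_zero] at hκ
  simp only [map_mul, map_add, map_sub, map_pow, map_one, map_ofNat, h0, h1, hκ, evalT_inT,
    evalT_specY, evalT3_killVar_one] at hA hB
  have hD := evalT3_hcSeries
  have hl := ell_spec
  have hN := ellN_spec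
  have hR := ellR_spec
  have hn0 : (1 - ell + ell ^ 2) ^ 3 ≠ 0 := ne_zero_of_constantCoeff (by simp [constantCoeff_ell])
  have hm0 : (1 - ell) * (1 + ell) ^ 3 ≠ 0 :=
    ne_zero_of_constantCoeff (by simp [constantCoeff_ell])
  generalize ell = l at *
  generalize ellN = N at *
  generalize ellR = R at *
  generalize evalT ySol = B at *
  generalize evalT3 hcSeries = D at *
  generalize evalT3 hcSeriesPos = L at *
  have hTD : X () * D * ((1 - l) * (1 + l) ^ 3) = 2 * (l * (1 - l - l ^ 2 - l ^ 3)) := by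
    apply mul_left_cancel₀ (mul_ne_zero hn0 hm0)
    linear_combination ((1 - l) * (1 + l) ^ 3) ^ 2 * X () * hD +
      2 * ((1 - l) * (1 + l) ^ 3 * (1 - l - l ^ 2 - l ^ 3)) * hl
  have hNR : B * ((1 - l) * (1 + l) ^ 3) = (1 + l ^ 2) ^ 2 := by
    linear_combination (1 - l) * (1 + l) ^ 3 * hB + (1 + l) ^ 2 * (1 - R) * hN - hR
  have h2 : (2 : MvPowerSeries Unit ℚ) ≠ 0 := ne_zero_of_constantCoeff (by
    rw [map_ofNat]
    norm_num)
  apply mul_left_cancel₀ h2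
  linear_combination (-1) * (1 - l) * (1 + l) ^ 3 * hA - hTD - 2 * hNR

end Extraction

section DifferentialEquations

variable {A : Type*} [CommRing A] [IsDomain A] [Algebra ℚ A]

theorem ode_of_uniformization_aux {K : Type*} [Field K] [CharZero K] {z d e T G H I : K}
    (hz : z ≠ 0) (hz3 : z ^ 2 - 3 ≠ 0) (hT : 256 * T * z ^ 6 = (z ^ 2 - 1) * (z ^ 2 + 3) ^ 3)
    (hd : 2 * d * (z ^ 2 - 3) ^ 2 = z * (z ^ 2 - 1) * (z ^ 2 + 3))
    (he : 2 * e * (z ^ 2 - 3) ^ 2 + 8 * d ^ 2 * z * (z ^ 2 - 3) =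
      (5 * z ^ 4 + 6 * z ^ 2 - 3) * d) :
    (z ^ 3 * G = 3 + z ^ 4 → z ^ 4 * H = (z ^ 4 - 9) * d →
      4 * z ^ 3 * d * H + z ^ 4 * I = 4 * z ^ 3 * d ^ 2 + (z ^ 4 - 9) * e →
      3 * I - 2 * H = 4 * T * (12 * I - 4 * H - G)) ∧
    (z ^ 3 * G = -3 + 6 * z ^ 2 + z ^ 4 → z ^ 4 * H = (z ^ 2 - 3) ^ 2 * d →
      4 * z ^ 3 * d * H + z ^ 4 * I =
        4 * z * (z ^ 2 - 3) * d ^ 2 + (z ^ 2 - 3) ^ 2 * e →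
      3 * I - H = 4 * T * (12 * I - 8 * H + G)) := by
  have hT' : T = (z ^ 2 - 1) * (z ^ 2 + 3) ^ 3 / (256 * z ^ 6) := by
    field_simp
    linear_combination hT
  have hd' : d = z * (z ^ 2 - 1) * (z ^ 2 + 3) / (2 * (z ^ 2 - 3) ^ 2) := by
    field_simp
    linear_combination hd
  have he' : e = ((5 * z ^ 4 + 6 * z ^ 2 - 3) * d - 8 * d ^ 2 * z * (z ^ 2 - 3)) /
      (2 * (z ^ 2 - 3) ^ 2) := by
    field_simp
    linear_combination he
  constructor
  · intro hG hH hI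
    have hG' : G = (3 + z ^ 4) / z ^ 3 := by field_simp; linear_combination hG
    have hH' : H = (z ^ 4 - 9) * d / z ^ 4 := by field_simp; linear_combination hH
    have hI' : I = (4 * z ^ 3 * d ^ 2 + (z ^ 4 - 9) * e - 4 * z ^ 3 * d * H) / z ^ 4 := by
      field_simp
      linear_combination hI
    rw [hI', hH', hG', he', hd', hT']
    field_simp
    ring
  · intro hG hH hI
    have hG' : G = (-3 + 6 * z ^ 2 + z ^ 4) / z ^ 3 := by field_simp; linear_combination hG
    have hH' : H = (z ^ 2 - 3) ^ 2 * d / z ^ 4 := by field_simp; linear_combination hH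
    have hI' : I = (4 * z * (z ^ 2 - 3) * d ^ 2 + (z ^ 2 - 3) ^ 2 * e - 4 * z ^ 3 * d * H) /
        z ^ 4 := by
      field_simp
      linear_combination hI
    rw [hI', hH', hG', he', hd', hT']
    field_simp
    ring

theorem ode_of_uniformization (D : Derivation ℚ A A) {z T : A} (hz : z ≠ 0)
    (hz3 : z ^ 2 - 3 ≠ 0) (hz3' : z ^ 2 + 3 ≠ 0) (hDT : D T = T)
    (hT : 256 * T * z ^ 6 = (z ^ 2 - 1) * (z ^ 2 + 3) ^ 3) (G : A) :
    (z ^ 3 * G = 3 + z ^ 4 → 3 * D (D G) - 2 * D G = 4 * T * (12 * D (D G) - 4 * D G - G)) ∧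
    (z ^ 3 * G = -3 + 6 * z ^ 2 + z ^ 4 →
      3 * D (D G) - D G = 4 * T * (12 * D (D G) - 8 * D G + G)) := by
  have : CharZero A := algebraRat.charZero A
  have D1 : ∀ a b, D (a * b) = a * D b + b * D a := fun a b => by simp
  have D2 : ∀ (a : A) (k : ℕ), D (a ^ (k + 1)) = (k + 1) * a ^ k * D a := fun a k => by
    rw [D.leibniz_pow]
    simp [mul_assoc]
  have D3 : ∀ k : ℕ, D (k : A) = 0 := fun k => D.map_natCast k
  have hd : 2 * D z * (z ^ 2 - 3) ^ 2 = z * (z ^ 2 - 1) * (z ^ 2 + 3) := by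
    have h := congrArg D hT
    have c1 := D3 256
    have c2 := D3 1
    have c3 := D3 3
    push_cast at c1 c2 c3
    simp only [D1, D2 z 5, D2 z 1, D2 _ 2, map_sub, map_add, c1, c2, c3, hDT] at h
    push_cast at h
    apply mul_left_cancel₀ (pow_ne_zero 2 hz3')
    linear_combination (-z) * h + (z + 6 * D z) * hT
  have he : 2 * D (D z) * (z ^ 2 - 3) ^ 2 + 8 * D z ^ 2 * z * (z ^ 2 - 3) =
      (5 * z ^ 4 + 6 * z ^ 2 - 3) * D z := by
    have h := congrArg D hd
    have c1 := D3 2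
    have c2 := D3 1
    have c3 := D3 3
    push_cast at c1 c2 c3
    simp only [D1, D2 _ 1, map_sub, map_add, c1, c2, c3] at h
    push_cast at h
    linear_combination h
  have hφ : Function.Injective (algebraMap A (FractionRing A)) := IsFractionRing.injective _ _
  have : CharZero (FractionRing A) := charZero_of_injective_algebraMap hφ
  generalize algebraMap A (FractionRing A) = φ at hφ
  have h0 : ∀ {x : A}, x ≠ 0 → φ x ≠ 0 := fun h => (map_ne_zero_iff φ hφ).2 h
  have key := ode_of_uniformization_aux (K := FractionRing A) (z := φ z) (d := φ (D z))
    (e := φ (D (D z))) (T := φ T) (G := φ G) (H := φ (D G)) (I := φ (D (D G))) (h0 hz)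
    (by simpa only [map_mul, map_add, map_sub, map_pow, map_one, map_ofNat] using h0 hz3)
    (by simpa only [map_mul, map_add, map_sub, map_pow, map_one, map_ofNat]
      using congrArg φ hT)
    (by simpa only [map_mul, map_add, map_sub, map_pow, map_one, map_ofNat]
      using congrArg φ hd)
    (by simpa only [map_mul, map_add, map_sub, map_pow, map_one, map_ofNat]
      using congrArg φ he)
  refine ⟨fun hG => hφ ?_, fun hG => hφ ?_⟩
  · have hH : z ^ 4 * D G = (z ^ 4 - 9) * D z := by
      have h := congrArg D hG
      have c3 := D3 3
      push_cast at c3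
      simp only [D1, D2 z 2, D2 z 3, map_add, c3] at h
      push_cast at h
      linear_combination z * h - 3 * D z * hG
    have hI : 4 * z ^ 3 * D z * D G + z ^ 4 * D (D G) =
        4 * z ^ 3 * D z ^ 2 + (z ^ 4 - 9) * D (D z) := by
      have h := congrArg D hH
      have c9 := D3 9
      push_cast at c9
      simp only [D1, D2 z 3, map_sub, c9] at h
      push_cast at h
      linear_combination h
    have hG' := congrArg φ hG
    have hH' := congrArg φ hH
    have hI' := congrArg φ hI
    simp only [map_mul, map_add, map_sub, map_pow, map_ofNat] at hG' hH' hI' ⊢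
    exact key.1 hG' hH' hI'
  · have hH : z ^ 4 * D G = (z ^ 2 - 3) ^ 2 * D z := by
      have h := congrArg D hG
      have c3 := D3 3
      have c6 := D3 6
      push_cast at c3 c6
      simp only [D1, D2 z 2, D2 z 3, D2 z 1, map_add, map_neg, c3, c6] at h
      push_cast at h
      linear_combination z * h - 3 * D z * hG
    have hI : 4 * z ^ 3 * D z * D G + z ^ 4 * D (D G) =
        4 * z * (z ^ 2 - 3) * D z ^ 2 + (z ^ 2 - 3) ^ 2 * D (D z) := by
      have h := congrArg D hH
      have c3 := D3 3
      push_cast at c3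
      simp only [D1, D2 z 3, D2 _ 1, map_sub, c3] at h
      push_cast at h
      linear_combination h
    have hG' := congrArg φ hG
    have hH' := congrArg φ hH
    have hI' := congrArg φ hI
    simp only [map_mul, map_add, map_sub, map_neg, map_pow, map_ofNat] at hG' hH' hI' ⊢
    exact key.2 hG' hH' hI'

end DifferentialEquations

section Hypergeometric

open PowerSeries

theorem poch_zero (a : ℚ) : poch a 0 = 1 := by simp [poch]

theorem poch_succ (a : ℚ) (n : ℕ) : poch a (n + 1) = poch a n * (a + n) :=
  ascPochhammer_succ_eval n a

theorem poch_pos {a : ℚ} (ha : 0 < a) (n : ℕ) : 0 < poch a n := ascPochhammer_pos n a ha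

theorem catalan_eq_poch (n : ℕ) : (catalan n : ℚ) = 4 ^ n * poch (1 / 2) n / poch 2 n := by
  induction n with
  | zero => simp [poch_zero]
  | succ n ih =>
    have h2 := (poch_pos (a := 2) (by norm_num) n).ne'
    have hn : (2 + n : ℚ) ≠ 0 := by positivity
    have h : ((n + 2 : ℕ) : ℚ) * catalan (n + 1) = 2 * (2 * n + 1) * catalan n := by
      have e₁ := succ_mul_catalan_eq_centralBinom n
      have e₂ := succ_mul_catalan_eq_centralBinom (n + 1)
      have e₃ := Nat.succ_mul_centralBinom_succ n
      rw [← e₁, ← e₂] at e₃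
      have e₄ : (n + 2) * catalan (n + 1) = 2 * (2 * n + 1) * catalan n :=
        mul_left_cancel₀ n.succ_ne_zero (by rw [Nat.succ_eq_add_one]; linear_combination e₃)
      exact_mod_cast e₄
    rw [ih] at h
    rw [poch_succ, poch_succ]
    push_cast at h
    field_simp at h ⊢
    linear_combination 2 * h

/-- The operator `X * d/dX` on rational power series. -/
noncomputable def eulerOp : Derivation ℚ ℚ⟦X⟧ ℚ⟦X⟧ := (X : ℚ⟦X⟧) • derivative ℚ

theorem eulerOp_X : eulerOp X = X := by simp [eulerOp]

theorem coeff_eulerOp (f : ℚ⟦X⟧) (n : ℕ) : coeff n (eulerOp f) = n * coeff n f := by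
  cases n with
  | zero => simp [eulerOp]
  | succ n =>
    simp only [eulerOp, Derivation.smul_apply, smul_eq_mul, coeff_succ_X_mul, coeff_derivative]
    push_cast
    ring

theorem coeff_succ_of_ode {p q r s t : ℚ} {G : ℚ⟦X⟧}
    (h : p • eulerOp (eulerOp G) - q • eulerOp G =
      X * (r • eulerOp (eulerOp G) - s • eulerOp G + t • G)) (n : ℕ) :
    (p * (n + 1) ^ 2 - q * (n + 1)) * coeff (n + 1) G =
      (r * n ^ 2 - s * n + t) * coeff n G := by
  have := congrArg (coeff (n + 1)) h
  simp only [coeff_succ_X_mul, map_sub, map_add, coeff_smul, coeff_eulerOp, smul_eq_mul] at this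
  push_cast at this
  linear_combination this

/-- The hypergeometric term `16 ^ n (1/2)_n (a)_n / ((2)_n (b)_n)`. -/
noncomputable def hyperTerm (a b : ℚ) (n : ℕ) : ℚ :=
  16 ^ n * (poch (1 / 2) n * poch a n) / (poch 2 n * poch b n)

theorem eq_hyperTerm {a b : ℚ} (hb : 0 < b) {c : ℕ → ℚ}
    (h : ∀ n, (n + 2) * (n + b) * c (n + 1) = 16 * (n + 1 / 2) * (n + a) * c n) (n : ℕ) :
    c n = c 0 * hyperTerm a b n := by
  induction n with
  | zero => simp [hyperTerm, poch_zero]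
  | succ n ih =>
    have h2 := (poch_pos (a := 2) (by norm_num) n).ne'
    have hb' := (poch_pos hb n).ne'
    have e₁ : (n + 2 : ℚ) ≠ 0 := by positivity
    have e₂ : (n + b : ℚ) ≠ 0 := by positivity
    refine mul_left_cancel₀ (mul_ne_zero e₁ e₂) ?_
    rw [h, ih]
    simp only [hyperTerm, poch_succ, add_comm (2 : ℚ), add_comm b, add_comm a,
      add_comm (1 / 2 : ℚ)]
    field_simp
    ring

theorem coeff_eq_hyperTerm_of_uniformization {l L : ℚ⟦X⟧} (hl0 : constantCoeff l = 0)
    (hl : X * ((1 - l) ^ 2 * (1 + l) ^ 6) = l * (1 - l + l ^ 2) ^ 3)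
    (hL : X * L * ((1 - l) * (1 + l) ^ 3) = l * (1 - l - l ^ 2 - l ^ 3)) (n : ℕ) :
    3 * coeff n L = 4 * hyperTerm (7 / 6) (4 / 3) n - hyperTerm (5 / 6) (5 / 3) n := by
  have ne_zero : ∀ {f : ℚ⟦X⟧}, constantCoeff f ≠ 0 → f ≠ 0 := fun h h' => h (by simp [h'])
  obtain ⟨W, hW⟩ : ∃ W, W * (1 - l) = 1 :=
    ⟨(1 - l)⁻¹, PowerSeries.inv_mul_cancel _ (by simp [hl0])⟩
  obtain ⟨V, hV⟩ : ∃ V, V * (1 + l) = 1 :=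
    ⟨(1 + l)⁻¹, PowerSeries.inv_mul_cancel _ (by simp [hl0])⟩
  obtain ⟨z, hz⟩ : ∃ z, z = (1 + l) * W := ⟨_, rfl⟩
  obtain ⟨y, hy⟩ : ∃ y, y = (1 - l) * V := ⟨_, rfl⟩
  have hzy : z * y = 1 := by rw [hz, hy]; linear_combination W * (1 - l) * hV + hW
  have W0 : constantCoeff W = 1 := by simpa [hl0] using congrArg constantCoeff hW
  have V0 : constantCoeff V = 1 := by simpa [hl0] using congrArg constantCoeff hV
  have z0 : constantCoeff z = 1 := by simp [hz, hl0, W0]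
  have y0 : constantCoeff y = 1 := by simp [hy, hl0, V0]
  have e₁ : z ^ 2 - 1 = 4 * l * W ^ 2 := by
    rw [hz]
    linear_combination (W * (1 - l) + 1) * hW
  have e₂ : z ^ 2 + 3 = 4 * (1 - l + l ^ 2) * W ^ 2 := by
    rw [hz]
    linear_combination (-3) * (W * (1 - l) + 1) * hW
  have hT : 256 * X * z ^ 6 = (z ^ 2 - 1) * (z ^ 2 + 3) ^ 3 := by
    rw [e₁, e₂, hz]
    linear_combination 256 * W ^ 8 * hl - 256 * X * (1 + l) ^ 6 * W ^ 6 * (W * (1 - l) + 1) * hW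
  have n₁ : z ≠ 0 := ne_zero (by simp [z0])
  have n₂ : z ^ 2 - 3 ≠ 0 := ne_zero (by
    simp only [map_sub, map_pow, z0, map_ofNat]; norm_num)
  have n₃ : z ^ 2 + 3 ≠ 0 := ne_zero (by
    simp only [map_add, map_pow, z0, map_ofNat]; norm_num)
  obtain ⟨G, hG⟩ : ∃ G, G = 3 * y ^ 3 + z := ⟨_, rfl⟩
  obtain ⟨H, hH⟩ : ∃ H, H = -3 * y ^ 3 + 6 * y + z := ⟨_, rfl⟩
  have hy3 : z ^ 3 * y ^ 3 = 1 := by rw [← mul_pow, hzy, one_pow]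
  have odeG := (ode_of_uniformization eulerOp n₁ n₂ n₃ eulerOp_X hT G).1 (by
    rw [hG]; linear_combination 3 * hy3)
  have odeH := (ode_of_uniformization eulerOp n₁ n₂ n₃ eulerOp_X hT H).2 (by
    rw [hH]; linear_combination (-3) * hy3 + 6 * z ^ 2 * hzy)
  have recG := coeff_succ_of_ode (p := 3) (q := 2) (r := 48) (s := 16) (t := -4) (G := G) (by
    simp only [smul_eq_C_mul, map_neg, map_ofNat]
    linear_combination odeG)
  have recH := coeff_succ_of_ode (p := 3) (q := 1) (r := 48) (s := 32) (t := 4) (G := H) (by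
    simp only [smul_eq_C_mul, map_one, map_ofNat]
    linear_combination odeH)
  have G0 : coeff 0 G = 4 := by
    rw [coeff_zero_eq_constantCoeff_apply, hG]
    simp only [map_add, map_mul, map_pow, y0, z0, map_ofNat]
    norm_num
  have H0 : coeff 0 H = 4 := by
    rw [coeff_zero_eq_constantCoeff_apply, hH]
    simp only [map_add, map_mul, map_pow, map_neg, y0, z0, map_ofNat]
    norm_num
  have G1 : coeff 1 G = -16 := by
    have := recG 0
    norm_num [G0] at this ⊢
    linear_combination this
  have H1 : coeff 1 H = 8 := by
    have := recH 0
    norm_num [H0] at this ⊢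
    linear_combination this / 2
  have solG := eq_hyperTerm (a := 7 / 6) (b := 4 / 3) (by norm_num)
    (c := fun n => coeff (n + 1) G) (fun n => by
      have := recG (n + 1)
      push_cast at this
      linear_combination this / 3) n
  have solH := eq_hyperTerm (a := 5 / 6) (b := 5 / 3) (by norm_num)
    (c := fun n => coeff (n + 1) H) (fun n => by
      have := recH (n + 1)
      push_cast at this
      linear_combination this / 3) n
  simp only [zero_add, G1, H1] at solG solH
  have key : (24 : ℚ) • (X * L) = (12 : ℚ) • 1 - (2 : ℚ) • G - H := by
    simp only [smul_eq_C_mul, map_ofNat]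
    rw [hG, hH]
    have hz' : z * (1 - l) = 1 + l := by rw [hz]; linear_combination (1 + l) * hW
    have hy' : y * (1 + l) = 1 - l := by rw [hy]; linear_combination (1 - l) * hV
    have hy3' : y ^ 3 * (1 + l) ^ 3 = (1 - l) ^ 3 := by rw [← mul_pow, hy']
    have n₄ : (1 - l) * (1 + l) ^ 3 ≠ 0 := ne_zero (by simp [hl0])
    refine mul_left_cancel₀ n₄ ?_
    linear_combination 24 * hL + 3 * (1 + l) ^ 3 * hz' + 6 * (1 - l) * (1 + l) ^ 2 * hy' +
      3 * (1 - l) * hy3'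
  have hc := congrArg (coeff (n + 1)) key
  simp only [map_sub, coeff_smul, coeff_succ_X_mul, smul_eq_mul, solG, solH, coeff_one,
    Nat.succ_ne_zero, if_false] at hc
  linear_combination hc / 8

end Hypergeometric

theorem halfCone_eq_hyperTerm (n : ℕ) :
    3 * halfCone 0 1 n = 4 * hyperTerm (7 / 6) (4 / 3) n - hyperTerm (5 / 6) (5 / 3) n := by
  have h := coeff_eq_hyperTerm_of_uniformization (l := ell) (L := evalT3 hcSeriesPos)
    constantCoeff_ell ell_spec evalT3_hcSeriesPos n
  have hc : PowerSeries.coeff n (evalT3 hcSeriesPos) = halfCone 0 1 n := by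
    refine (coeff_evalT3 hcSeriesPos n).trans ?_
    simp [hcSeriesPos, coeff_series3]
  rwa [hc] at h

theorem diag_threeQuadrant_endMinusTwo_count (n : ℕ) :
    (walkCount diagSteps coneC (0, 0) (-2, 0) (2*n) : ℚ) =
      16^n / 9 *
        (-3 * (poch (1/2) n)^2 / (poch 2 n)^2
          + 4 * (poch (1/2) n * poch (7/6) n) / (poch 2 n * poch (4/3) n)
          - (poch (1/2) n * poch (5/6) n) / (poch 2 n * poch (5/3) n)) := by
  rw [walkCount_eq_halfCone]
  have h := halfCone_eq_hyperTerm n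
  have hc : (catalan n : ℚ) ^ 2 = 16 ^ n * (poch (1 / 2) n) ^ 2 / (poch 2 n) ^ 2 := by
    rw [catalan_eq_poch, div_pow, mul_pow, ← pow_mul, mul_comm n, pow_mul]
    norm_num
  rw [hc]
  unfold hyperTerm at h
  linear_combination h / 9
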